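/- For every nonempty primary basic semialgebraic set V ⊆ ℝ^m defined over ℤ, there exists a polytope P (in some dimension d, with some number n of vertices) such that V is stably equivalent to the realization space ℛ(P). -/

import Mathlib

noncomputable section

/-- A primary basic semialgebraic set in `ℝ^m` defined over `ℤ`: the solution set of finitely
many polynomial equalities and *strict* polynomial inequalities with integer coefficients. -/
def IsPrimaryBasicSemialgebraicZ {m : ℕ} (S : Set (Fin m → ℝ)) : Prop :=
  ∃ (k l : ℕ) (f : Fin k → MvPolynomial (Fin m) ℤ) (g : Fin l → MvPolynomial (Fin m) ℤ),
    S = {x : Fin m → ℝ |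
      (∀ i, MvPolynomial.aeval x (f i) = (0 : ℝ)) ∧
      (∀ j, (0 : ℝ) < MvPolynomial.aeval x (g j))}

/-- `S ⊆ ℝ^d` is a stable projection of `T ⊆ ℝ^{d+d'}`: the coordinate projection maps `T`
onto `S`, and over each `x ∈ S` the fiber of `T` is a nonempty set given by linear equalities
and strict linear inequalities in the fiber variables, whose coefficients depend polynomially
on `x` (i.e. the relative interior of a nonempty polyhedron depending polynomially on `x`). -/
def IsStableProjection {d d' : ℕ} (S : Set (Fin d → ℝ)) (T : Set (Fin (d + d') → ℝ)) : Prop :=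
  ∃ (k l : ℕ) (A : Fin k → Fin d' → MvPolynomial (Fin d) ℝ) (b : Fin k → MvPolynomial (Fin d) ℝ)
    (C : Fin l → Fin d' → MvPolynomial (Fin d) ℝ) (c : Fin l → MvPolynomial (Fin d) ℝ),
    (∀ x ∈ S, ∃ y : Fin d' → ℝ, Fin.append x y ∈ T) ∧
    ∀ (x : Fin d → ℝ) (y : Fin d' → ℝ),
      Fin.append x y ∈ T ↔
        x ∈ S ∧
        (∀ i, (∑ j, MvPolynomial.eval x (A i j) * y j) + MvPolynomial.eval x (b i) = 0) ∧
        (∀ i, 0 < (∑ j, MvPolynomial.eval x (C i j) * y j) + MvPolynomial.eval x (c i))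

/-- `f` is coordinatewise a rational function on `S` (denominators nonvanishing on `S`). -/
def IsRationalMapOn {d e : ℕ} (S : Set (Fin d → ℝ)) (f : (Fin d → ℝ) → Fin e → ℝ) : Prop :=
  ∀ i : Fin e, ∃ p q : MvPolynomial (Fin d) ℝ, ∀ x ∈ S,
    MvPolynomial.eval x q ≠ 0 ∧ f x i = MvPolynomial.eval x p / MvPolynomial.eval x q

/-- `S` and `T` are rationally equivalent: there are mutually inverse bijections between them
which are coordinatewise rational (hence in particular a homeomorphism). -/
def RationallyEquivalent {d e : ℕ} (S : Set (Fin d → ℝ)) (T : Set (Fin e → ℝ)) : Prop :=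
  ∃ (f : (Fin d → ℝ) → Fin e → ℝ) (g : (Fin e → ℝ) → Fin d → ℝ),
    IsRationalMapOn S f ∧ IsRationalMapOn T g ∧
    (∀ x ∈ S, f x ∈ T) ∧ (∀ y ∈ T, g y ∈ S) ∧
    (∀ x ∈ S, g (f x) = x) ∧ (∀ y ∈ T, f (g y) = y)

/-- One generating step of stable equivalence: a stable projection (in either direction,
symmetry being supplied by the generated equivalence) or a rational equivalence. -/
def StableStep (X Y : Σ d : ℕ, Set (Fin d → ℝ)) : Prop :=
  (∃ (d' : ℕ) (T : Set (Fin (X.1 + d') → ℝ)),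
      Y = ⟨X.1 + d', T⟩ ∧ IsStableProjection X.2 T) ∨
  RationallyEquivalent X.2 Y.2

/-- Stable equivalence: the equivalence relation generated by stable projections and
rational equivalences. -/
def StablyEquivalent (X Y : Σ d : ℕ, Set (Fin d → ℝ)) : Prop :=
  Relation.EqvGen StableStep X Y

/-- The index of the `c`-th coordinate of the `p`-th point in the flattening
`(ℝ^d)^n ≃ ℝ^{d·n}`. -/
def flatIdx {n d : ℕ} (p : Fin n) (c : Fin d) : Fin (d * n) :=
  ⟨d * p.1 + c.1, by
    have h1 : d * (p.1 + 1) ≤ d * n := Nat.mul_le_mul le_rfl p.2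
    have h2 : d * (p.1 + 1) = d * p.1 + d := by ring
    have h3 := c.2
    omega⟩

/-- Flatten a set of point configurations `(ℝ^d)^n` into a subset of `ℝ^{d·n}`. -/
def flat {n d : ℕ} (R : Set (Fin n → Fin d → ℝ)) : Set (Fin (d * n) → ℝ) :=
  {x | (fun (p : Fin n) (c : Fin d) => x (flatIdx p c)) ∈ R}

/-- `v '' S` is the set of extreme points of some face of the polytope `conv (range v)`;
the faces of a polytope `Q` are `Q` itself, `∅`, and the exposed faces of `Q`
(`∅` is exposed). -/
def IsVertexSetOfFace {n d : ℕ} (v : Fin n → Fin d → ℝ) (S : Finset (Fin n)) : Prop :=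
  ∃ F : Set (Fin d → ℝ),
    (F = convexHull ℝ (Set.range v) ∨ IsExposed ℝ (convexHull ℝ (Set.range v)) F) ∧
    Set.extremePoints ℝ F = v '' ↑S

/-- `v` lists the `n` vertices of a (full-dimensional) polytope in `ℝ^d`: the `v i` are
pairwise distinct, each is an extreme point of their convex hull, and they affinely
span `ℝ^d` (so the polytope has dimension `d`). -/
def IsPolytopeVertexList {n d : ℕ} (v : Fin n → Fin d → ℝ) : Prop :=
  Function.Injective v ∧
  (∀ i, v i ∈ Set.extremePoints ℝ (convexHull ℝ (Set.range v))) ∧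
  affineSpan ℝ (Set.range v) = ⊤

/-- The (normalized) realization space of the polytope with vertex list `v`, with respect to
the affine basis indexed by `B`: labeled point configurations `x` fixing the basis, all of
whose points are vertices of their convex hull, with the same vertex sets of faces as `v`. -/
def polytopeRealizationSpace {n d : ℕ} (v : Fin n → Fin d → ℝ) (B : Finset (Fin n)) :
    Set (Fin n → Fin d → ℝ) :=
  {x | (∀ i ∈ B, x i = v i) ∧
    (∀ i, x i ∈ Set.extremePoints ℝ (convexHull ℝ (Set.range x))) ∧
    ∀ S : Finset (Fin n), IsVertexSetOfFace x S ↔ IsVertexSetOfFace v S}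

/-- A `d`-polytope with vertex list `v` is neighborly if every set of at most `⌊d/2⌋`
vertices is the vertex set of a face. -/
def IsNeighborly {n d : ℕ} (v : Fin n → Fin d → ℝ) : Prop :=
  ∀ S : Finset (Fin n), S.card ≤ d / 2 → IsVertexSetOfFace v S

/-- A polytope is simplicial if all of its proper faces are simplices. -/
def IsSimplicialVertexList {n d : ℕ} (v : Fin n → Fin d → ℝ) : Prop :=
  ∀ F : Set (Fin d → ℝ), IsExposed ℝ (convexHull ℝ (Set.range v)) F →
    F ≠ convexHull ℝ (Set.range v) →
    ∃ s : Finset (Fin d → ℝ),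
      AffineIndependent ℝ (fun x : ↥s => (x : Fin d → ℝ)) ∧ F = convexHull ℝ ↑s

namespace Universality

open MvPolynomial

/-- A function given by a polynomial. -/
def PolyFn {ι : Type*} (f : (ι → ℝ) → ℝ) : Prop :=
  ∃ p : MvPolynomial ι ℝ, ∀ x, f x = eval x p

namespace PolyFn

variable {ι : Type*} {f g : (ι → ℝ) → ℝ}

theorem const (c : ℝ) : PolyFn (fun _ : ι → ℝ => c) := ⟨C c, fun x => by simp⟩

theorem coord (i : ι) : PolyFn (fun x : ι → ℝ => x i) := ⟨X i, fun x => by simp⟩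

theorem add (hf : PolyFn f) (hg : PolyFn g) : PolyFn (fun x => f x + g x) := by
  obtain ⟨p, hp⟩ := hf
  obtain ⟨q, hq⟩ := hg
  exact ⟨p + q, fun x => by simp [hp, hq]⟩

theorem mul (hf : PolyFn f) (hg : PolyFn g) : PolyFn (fun x => f x * g x) := by
  obtain ⟨p, hp⟩ := hf
  obtain ⟨q, hq⟩ := hg
  exact ⟨p * q, fun x => by simp [hp, hq]⟩

theorem neg (hf : PolyFn f) : PolyFn (fun x => - f x) := by
  obtain ⟨p, hp⟩ := hf
  exact ⟨-p, fun x => by simp [hp]⟩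

theorem sub (hf : PolyFn f) (hg : PolyFn g) : PolyFn (fun x => f x - g x) := by
  simpa [sub_eq_add_neg] using hf.add hg.neg

theorem sum {α : Type*} (s : Finset α) {F : α → (ι → ℝ) → ℝ} (h : ∀ a ∈ s, PolyFn (F a)) :
    PolyFn (fun x => ∑ a ∈ s, F a x) := by
  classical
  induction s using Finset.induction_on with
  | empty => simpa using const 0
  | insert a s ha ih =>
    simp only [Finset.sum_insert ha]
    exact (h a (by simp)).add (ih fun b hb => h b (by simp [hb]))

end PolyFn

/-- A function given on `S` by a quotient of polynomials without poles on `S`. -/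
def RatOn {ι : Type*} (S : Set (ι → ℝ)) (f : (ι → ℝ) → ℝ) : Prop :=
  ∃ p q : MvPolynomial ι ℝ, ∀ x ∈ S, eval x q ≠ 0 ∧ f x = eval x p / eval x q

theorem PolyFn.ratOn {ι : Type*} {f : (ι → ℝ) → ℝ} (hf : PolyFn f) (S : Set (ι → ℝ)) :
    RatOn S f := by
  obtain ⟨p, hp⟩ := hf
  exact ⟨p, 1, fun x _ => by simp [hp]⟩

namespace RatOn

variable {ι : Type*} {S : Set (ι → ℝ)} {f g : (ι → ℝ) → ℝ}

theorem const (c : ℝ) : RatOn S (fun _ => c) := (PolyFn.const c).ratOn S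

theorem coord (i : ι) : RatOn S (fun x => x i) := (PolyFn.coord i).ratOn S

theorem add (hf : RatOn S f) (hg : RatOn S g) : RatOn S (fun x => f x + g x) := by
  obtain ⟨p, q, h⟩ := hf
  obtain ⟨p', q', h'⟩ := hg
  refine ⟨p * q' + q * p', q * q', fun x hx => ?_⟩
  obtain ⟨h1, h2⟩ := h x hx
  obtain ⟨h3, h4⟩ := h' x hx
  refine ⟨by simp [h1, h3], ?_⟩
  simp only [map_add, map_mul, h2, h4]
  exact div_add_div _ _ h1 h3

theorem mul (hf : RatOn S f) (hg : RatOn S g) : RatOn S (fun x => f x * g x) := by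
  obtain ⟨p, q, h⟩ := hf
  obtain ⟨p', q', h'⟩ := hg
  refine ⟨p * p', q * q', fun x hx => ?_⟩
  obtain ⟨h1, h2⟩ := h x hx
  obtain ⟨h3, h4⟩ := h' x hx
  refine ⟨by simp [h1, h3], ?_⟩
  simp only [map_mul, h2, h4]
  exact div_mul_div_comm _ _ _ _

theorem neg (hf : RatOn S f) : RatOn S (fun x => - f x) := by
  simpa using (const (S := S) (-1)).mul hf

theorem sub (hf : RatOn S f) (hg : RatOn S g) : RatOn S (fun x => f x - g x) := by
  simpa [sub_eq_add_neg] using hf.add hg.neg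

theorem div (hf : RatOn S f) (hg : RatOn S g) (h0 : ∀ x ∈ S, g x ≠ 0) :
    RatOn S (fun x => f x / g x) := by
  obtain ⟨p, q, h⟩ := hf
  obtain ⟨p', q', h'⟩ := hg
  refine ⟨p * q', q * p', fun x hx => ?_⟩
  obtain ⟨h1, h2⟩ := h x hx
  obtain ⟨h3, h4⟩ := h' x hx
  have h5 := h0 x hx
  rw [h4] at h5
  have h6 : eval x p' ≠ 0 := fun h => h5 (by simp [h])
  refine ⟨by simp [h1, h6], ?_⟩
  simp only [map_mul, h2, h4]
  exact div_div_div_eq _ _ _ _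

end RatOn

/-- A function affine in the fibre variable `y`, with coefficients polynomial in `x`. -/
def FibreAffine {ι κ : Type*} [Fintype κ] (L : (ι → ℝ) → (κ → ℝ) → ℝ) : Prop :=
  ∃ (A : κ → MvPolynomial ι ℝ) (b : MvPolynomial ι ℝ),
    ∀ x y, L x y = ∑ j, eval x (A j) * y j + eval x b

namespace FibreAffine

variable {ι κ : Type*} [Fintype κ] {L M : (ι → ℝ) → (κ → ℝ) → ℝ}

theorem base {f : (ι → ℝ) → ℝ} (hf : PolyFn f) :
    FibreAffine (fun x (_ : κ → ℝ) => f x) := by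
  obtain ⟨p, hp⟩ := hf
  exact ⟨0, p, fun x y => by simp [hp]⟩

theorem coord (j : κ) : FibreAffine (fun (_ : ι → ℝ) (y : κ → ℝ) => y j) := by
  classical
  exact ⟨fun i => if i = j then 1 else 0, 0, fun x y => by simp [apply_ite]⟩

theorem add (hL : FibreAffine L) (hM : FibreAffine M) :
    FibreAffine (fun x y => L x y + M x y) := by
  obtain ⟨A, b, h⟩ := hL
  obtain ⟨A', b', h'⟩ := hM
  refine ⟨fun j => A j + A' j, b + b', fun x y => ?_⟩
  simp only [h, h', map_add, add_mul, Finset.sum_add_distrib]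
  ring

theorem smul {f : (ι → ℝ) → ℝ} (hf : PolyFn f) (hL : FibreAffine L) :
    FibreAffine (fun x y => f x * L x y) := by
  obtain ⟨p, hp⟩ := hf
  obtain ⟨A, b, h⟩ := hL
  refine ⟨fun j => p * A j, p * b, fun x y => ?_⟩
  simp only [h, hp, map_mul, mul_add, Finset.mul_sum, mul_assoc]

theorem sub (hL : FibreAffine L) (hM : FibreAffine M) :
    FibreAffine (fun x y => L x y - M x y) := by
  simpa [sub_eq_add_neg] using hL.add (smul (PolyFn.const (-1)) hM)

theorem sum {α : Type*} (s : Finset α) {F : α → (ι → ℝ) → (κ → ℝ) → ℝ}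
    (h : ∀ a ∈ s, FibreAffine (F a)) : FibreAffine (fun x y => ∑ a ∈ s, F a x y) := by
  classical
  induction s using Finset.induction_on with
  | empty => simpa using base (PolyFn.const 0)
  | insert a s ha ih =>
    simp only [Finset.sum_insert ha]
    exact (h a (by simp)).add (ih fun b hb => h b (by simp [hb]))

end FibreAffine

/-- The set `S ⊆ ℝ^ι`, with coordinates enumerated along `e`. -/
def enumSet {ι : Type*} {n : ℕ} (e : ι ≃ Fin n) (S : Set (ι → ℝ)) : Set (Fin n → ℝ) :=
  {x | (fun i => x (e i)) ∈ S}

theorem rationallyEquivalent_enumSet {ι κ : Type*} {n m : ℕ} (e : ι ≃ Fin n) (e' : κ ≃ Fin m)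
    {S : Set (ι → ℝ)} {T : Set (κ → ℝ)} (f : (ι → ℝ) → κ → ℝ) (g : (κ → ℝ) → ι → ℝ)
    (hf : ∀ k, RatOn S (fun x => f x k)) (hg : ∀ i, RatOn T (fun y => g y i))
    (hfT : ∀ x ∈ S, f x ∈ T) (hgS : ∀ y ∈ T, g y ∈ S)
    (hgf : ∀ x ∈ S, g (f x) = x) (hfg : ∀ y ∈ T, f (g y) = y) :
    RationallyEquivalent (enumSet e S) (enumSet e' T) := by
  refine ⟨fun x k => f (fun i => x (e i)) (e'.symm k), fun y i => g (fun k => y (e' k)) (e.symm i),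
    fun k => ?_, fun i => ?_, fun x hx => ?_, fun y hy => ?_, fun x hx => ?_, fun y hy => ?_⟩
  · obtain ⟨p, q, h⟩ := hf (e'.symm k)
    refine ⟨rename e p, rename e q, fun x hx => ?_⟩
    simpa [eval_rename, Function.comp_def] using h _ hx
  · obtain ⟨p, q, h⟩ := hg (e.symm i)
    refine ⟨rename e' p, rename e' q, fun x hx => ?_⟩
    simpa [eval_rename, Function.comp_def] using h _ hx
  · simpa [enumSet] using hfT _ hx
  · simpa [enumSet] using hgS _ hy
  · funext i
    simpa using congrFun (hgf _ hx) (e.symm i)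
  · funext i
    simpa using congrFun (hfg _ hy) (e'.symm i)

/-- Stable equivalence for sets whose coordinates are indexed by arbitrary finite types. -/
def SEq {ι κ : Type*} [Fintype ι] [Fintype κ] (S : Set (ι → ℝ)) (T : Set (κ → ℝ)) : Prop :=
  StablyEquivalent ⟨_, enumSet (Fintype.equivFin ι) S⟩ ⟨_, enumSet (Fintype.equivFin κ) T⟩

namespace SEq

variable {ι κ ν : Type*} [Fintype ι] [Fintype κ] [Fintype ν]

theorem symm {S : Set (ι → ℝ)} {T : Set (κ → ℝ)} (h : SEq S T) : SEq T S :=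
  Relation.EqvGen.symm _ _ h

theorem trans {S : Set (ι → ℝ)} {T : Set (κ → ℝ)} {U : Set (ν → ℝ)} (h : SEq S T)
    (h' : SEq T U) : SEq S U :=
  Relation.EqvGen.trans _ _ _ h h'

theorem refl (S : Set (ι → ℝ)) : SEq S S := Relation.EqvGen.refl _

theorem of_ratOn {S : Set (ι → ℝ)} {T : Set (κ → ℝ)} (f : (ι → ℝ) → κ → ℝ)
    (g : (κ → ℝ) → ι → ℝ)
    (hf : ∀ k, RatOn S (fun x => f x k)) (hg : ∀ i, RatOn T (fun y => g y i))
    (hfT : ∀ x ∈ S, f x ∈ T) (hgS : ∀ y ∈ T, g y ∈ S)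
    (hgf : ∀ x ∈ S, g (f x) = x) (hfg : ∀ y ∈ T, f (g y) = y) : SEq S T :=
  Relation.EqvGen.rel _ _ (Or.inr (rationallyEquivalent_enumSet _ _ f g hf hg hfT hgS hgf hfg))

theorem of_fibre {α β : Type*} [Fintype α] [Fintype β] {S : Set (ι → ℝ)} {T : Set (ι ⊕ κ → ℝ)}
    (L : α → (ι → ℝ) → (κ → ℝ) → ℝ) (M : β → (ι → ℝ) → (κ → ℝ) → ℝ)
    (hL : ∀ a, FibreAffine (L a)) (hM : ∀ b, FibreAffine (M b))
    (hT : ∀ x y, Sum.elim x y ∈ T ↔ x ∈ S ∧ (∀ a, L a x y = 0) ∧ ∀ b, 0 < M b x y)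
    (hne : ∀ x ∈ S, ∃ y, (∀ a, L a x y = 0) ∧ ∀ b, 0 < M b x y) : SEq S T := by
  classical
  let e := Fintype.equivFin ι
  let e' := Fintype.equivFin κ
  let s : ι ⊕ κ ≃ Fin (Fintype.card ι + Fintype.card κ) := (Equiv.sumCongr e e').trans finSumFinEquiv
  have key : ∀ (x : Fin (Fintype.card ι) → ℝ) (y : Fin (Fintype.card κ) → ℝ),
      (fun i => Fin.append x y (s i)) = Sum.elim (fun i => x (e i)) (fun k => y (e' k)) := by
    intro x y
    funext i
    cases i <;> simp [s]
  choose A b hA using hL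
  choose C c hC using hM
  have hdot : ∀ (P : κ → ℝ) (y : Fin (Fintype.card κ) → ℝ),
      ∑ j, P (e'.symm j) * y j = ∑ j, P j * y (e' j) := by
    intro P y
    rw [← Equiv.sum_comp e']
    simp
  have h1 : StableStep ⟨_, enumSet e S⟩ ⟨_, enumSet s T⟩ := by
    refine Or.inl ⟨Fintype.card κ, enumSet s T, rfl, Fintype.card α, Fintype.card β,
      fun a j => rename e (A ((Fintype.equivFin α).symm a) (e'.symm j)),
      fun a => rename e (b ((Fintype.equivFin α).symm a)),
      fun a j => rename e (C ((Fintype.equivFin β).symm a) (e'.symm j)),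
      fun a => rename e (c ((Fintype.equivFin β).symm a)), ?_, ?_⟩
    · intro (x : Fin (Fintype.card ι) → ℝ) (hx : (fun i => x (e i)) ∈ S)
      obtain ⟨y, hy⟩ := hne _ hx
      refine ⟨fun j => y (e'.symm j), ?_⟩
      change (fun i => Fin.append x _ (s i)) ∈ T
      rw [key, hT]
      simpa using ⟨hx, hy⟩
    · intro (x : Fin (Fintype.card ι) → ℝ) y
      change (fun i => Fin.append x y (s i)) ∈ T ↔ (fun i => x (e i)) ∈ S ∧ _
      rw [key, hT]
      simp only [eval_rename, Function.comp_def, hA, hC, and_congr_right_iff]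
      intro _
      rw [(Fintype.equivFin α).symm.forall_congr_left, (Fintype.equivFin β).symm.forall_congr_left]
      simp [← hdot]
  refine Relation.EqvGen.trans _ _ _ (Relation.EqvGen.rel _ _ h1)
    (Relation.EqvGen.rel _ _ (Or.inr ?_))
  exact rationallyEquivalent_enumSet _ _ id id (fun _ => .coord _) (fun _ => .coord _)
    (fun _ h => h) (fun _ h => h) (fun _ _ => rfl) (fun _ _ => rfl)

theorem stablyEquivalent {n m : ℕ} {S : Set (Fin n → ℝ)} {T : Set (Fin m → ℝ)} (h : SEq S T) :
    StablyEquivalent ⟨n, S⟩ ⟨m, T⟩ := by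
  have aux : ∀ {k : ℕ} (U : Set (Fin k → ℝ)),
      StablyEquivalent ⟨k, U⟩ ⟨_, enumSet (Fintype.equivFin (Fin k)) U⟩ := fun {k} U =>
    Relation.EqvGen.rel _ _ (Or.inr (rationallyEquivalent_enumSet (Equiv.refl (Fin k)) _ id id
      (fun _ => .coord _) (fun _ => .coord _)
      (fun _ h => h) (fun _ h => h) (fun _ _ => rfl) (fun _ _ => rfl)))
  exact .trans _ _ _ (aux S) (.trans _ _ _ h (.symm _ _ (aux T)))

theorem nonempty {S : Set (ι → ℝ)} {T : Set (κ → ℝ)} (h : SEq S T) (hS : S.Nonempty) :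
    T.Nonempty := by
  have step : ∀ X Y, StableStep X Y → (X.2.Nonempty ↔ Y.2.Nonempty) := by
    rintro ⟨n, X⟩ ⟨m, Y⟩ (⟨d, U, hY, k, l, A, b, C, c, h1, h2⟩ | ⟨f, g, -, -, h1, h2, -, -⟩)
    · cases hY
      refine ⟨fun ⟨x, hx⟩ => ?_, fun ⟨z, hz⟩ => ?_⟩
      · obtain ⟨y, hy⟩ := h1 x hx
        exact ⟨_, hy⟩
      · change z ∈ U at hz
        rw [← Fin.append_castAdd_natAdd (f := z), h2] at hz
        exact ⟨_, hz.1⟩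
    · exact ⟨fun ⟨x, hx⟩ => ⟨_, h1 x hx⟩, fun ⟨y, hy⟩ => ⟨_, h2 y hy⟩⟩
  have all : ∀ X Y, StablyEquivalent X Y → (X.2.Nonempty ↔ Y.2.Nonempty) := by
    intro X Y hXY
    induction hXY with
    | rel X Y h => exact step X Y h
    | refl X => exact Iff.rfl
    | symm X Y _ ih => exact ih.symm
    | trans X Y Z _ _ ih ih' => exact ih.trans ih'
  obtain ⟨x, hx⟩ := hS
  obtain ⟨y, hy⟩ := (all _ _ h).1 ⟨fun i => x ((Fintype.equivFin ι).symm i), by simpa [enumSet] using hx⟩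
  exact ⟨_, hy⟩

end SEq

/-- The relation `x k = x i + x j` or `x k = x i * x j`. -/
structure Rel where
  isMul : Bool
  i : ℕ
  j : ℕ
  k : ℕ

/-- The equation encoded by a relation. -/
def Rel.Holds (r : Rel) (x : ℕ → ℝ) : Prop :=
  x r.k = if r.isMul then x r.i * x r.j else x r.i + x r.j

/-- A Shor system: variables `1 = x 0 < x 1 < ⋯ < x N`, subject to elementary additions and
multiplications, where the factors of a multiplication are different from `x 0`. -/
structure Sys where
  N : ℕ
  L : List Rel
  valid : ∀ r ∈ L, r.i ≤ N ∧ r.j ≤ N ∧ r.k ≤ N ∧ (r.isMul → 1 ≤ r.i ∧ 1 ≤ r.j)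

/-- The solutions of a Shor system. -/
def Sys.Sat (s : Sys) (x : ℕ → ℝ) : Prop :=
  x 0 = 1 ∧ (∀ i < s.N, x i < x (i + 1)) ∧ ∀ r ∈ s.L, r.Holds x

/-- Extension by zero of a finite sequence. -/
def ext {N : ℕ} (x : Fin (N + 1) → ℝ) (i : ℕ) : ℝ := if h : i < N + 1 then x ⟨i, h⟩ else 0

/-- The subset of `ℝ^{N+1}` defined by a predicate on sequences. -/
def zeroSet (N : ℕ) (C : (ℕ → ℝ) → Prop) : Set (Fin (N + 1) → ℝ) := {x | C (ext x)}

/-- A predicate that only depends on the first `N + 1` entries of a sequence. -/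
def DependsUpTo (N : ℕ) (C : (ℕ → ℝ) → Prop) : Prop :=
  ∀ x y : ℕ → ℝ, (∀ i ≤ N, x i = y i) → (C x → C y)

theorem DependsUpTo.and {N : ℕ} {C D : (ℕ → ℝ) → Prop} (hC : DependsUpTo N C)
    (hD : DependsUpTo N D) : DependsUpTo N (fun x => C x ∧ D x) :=
  fun x y h hx => ⟨hC x y h hx.1, hD x y h hx.2⟩

theorem DependsUpTo.mono {N M : ℕ} (hNM : N ≤ M) {C : (ℕ → ℝ) → Prop} (hC : DependsUpTo N C) :
    DependsUpTo M C :=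
  fun x y h => hC x y fun i hi => h i (hi.trans hNM)

theorem ext_snoc_of_le {N : ℕ} (x : Fin (N + 1) → ℝ) (a : ℝ) {i : ℕ} (hi : i ≤ N) :
    ext (Fin.snoc x a : Fin (N + 2) → ℝ) i = ext x i := by
  have h : i < N + 1 := by omega
  simp [ext, h, Fin.snoc, show i < N + 2 by omega]

theorem ext_snoc_last {N : ℕ} (x : Fin (N + 1) → ℝ) (a : ℝ) :
    ext (Fin.snoc x a : Fin (N + 2) → ℝ) (N + 1) = a := by
  simp [ext, Fin.snoc]

theorem polyFn_ext {N : ℕ} (i : ℕ) : PolyFn (fun x : Fin (N + 1) → ℝ => ext x i) := by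
  unfold ext
  split_ifs with h
  · exact PolyFn.coord _
  · exact PolyFn.const 0

theorem SEq.of_snoc {N : ℕ} {α β : Type*} [Fintype α] [Fintype β] {C C' : (ℕ → ℝ) → Prop}
    (hC : DependsUpTo N C)
    (L : α → (ℕ → ℝ) → ℝ → ℝ) (M : β → (ℕ → ℝ) → ℝ → ℝ)
    (hL : ∀ a, FibreAffine (fun (x : Fin (N + 1) → ℝ) (y : Unit → ℝ) => L a (ext x) (y ())))
    (hM : ∀ a, FibreAffine (fun (x : Fin (N + 1) → ℝ) (y : Unit → ℝ) => M a (ext x) (y ())))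
    (hC' : ∀ x : Fin (N + 1) → ℝ, ∀ a : ℝ, C' (ext (Fin.snoc x a : Fin (N + 2) → ℝ)) ↔
      C (ext (Fin.snoc x a : Fin (N + 2) → ℝ)) ∧ (∀ b, L b (ext x) a = 0) ∧
        ∀ b, 0 < M b (ext x) a)
    (hne : ∀ x : Fin (N + 1) → ℝ, C (ext x) → ∃ a, (∀ b, L b (ext x) a = 0) ∧
      ∀ b, 0 < M b (ext x) a) :
    SEq (zeroSet N C) (zeroSet (N + 1) C') := by
  have hsn : ∀ (x : Fin (N + 1) → ℝ) a, C (ext (Fin.snoc x a : Fin (N + 2) → ℝ)) ↔ C (ext x) :=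
    fun x a => ⟨hC _ _ fun i hi => ext_snoc_of_le x a hi,
      hC _ _ fun i hi => (ext_snoc_of_le x a hi).symm⟩
  refine (SEq.of_fibre (κ := Unit)
    (T := {z | C' (ext (Fin.snoc (fun i => z (.inl i)) (z (.inr ())) : Fin (N + 2) → ℝ))})
    (fun b x y => L b (ext x) (y ())) (fun b x y => M b (ext x) (y ())) hL hM ?_ ?_).trans ?_
  · intro x y
    change C' (ext (Fin.snoc x (y ()) : Fin (N + 2) → ℝ)) ↔ C (ext x) ∧ _
    rw [hC', hsn]
  · intro x hx
    obtain ⟨a, ha⟩ := hne x hx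
    exact ⟨fun _ => a, ha⟩
  · refine SEq.of_ratOn
      (fun z => (Fin.snoc (fun i => z (.inl i)) (z (.inr ())) : Fin (N + 2) → ℝ))
      (fun y => Sum.elim (fun i => y i.castSucc) (fun _ => y (Fin.last _))) ?_ ?_ ?_ ?_ ?_ ?_
    · intro k
      refine Fin.lastCases ?_ (fun i => ?_) k
      · simpa using RatOn.coord _
      · simpa using RatOn.coord _
    · rintro (i | i) <;> exact RatOn.coord _
    · intro z hz
      exact hz
    · intro y hy
      have : (Fin.snoc (fun i => y i.castSucc) (y (Fin.last _)) : Fin (N + 2) → ℝ) = y :=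
        Fin.snoc_init_self y
      simpa [this, zeroSet] using hy
    · intro z _
      funext i
      rcases i with i | i <;> simp
    · intro y _
      exact Fin.snoc_init_self y

namespace Sys

theorem Sat.le {s : Sys} {x : ℕ → ℝ} (h : s.Sat x) {i j : ℕ} (hij : i ≤ j) (hj : j ≤ s.N) :
    x i ≤ x j := by
  induction j, hij using Nat.le_induction with
  | base => exact le_rfl
  | succ j hij ih => exact (ih (by omega)).trans (h.2.1 j (by omega)).le

theorem Sat.one_le {s : Sys} {x : ℕ → ℝ} (h : s.Sat x) {i : ℕ} (hi : i ≤ s.N) : 1 ≤ x i :=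
  h.1 ▸ h.le (Nat.zero_le i) hi

theorem dependsUpTo_sat (s : Sys) : DependsUpTo s.N s.Sat := by
  rintro x y h ⟨h0, h1, h2⟩
  refine ⟨(h 0 (Nat.zero_le _)) ▸ h0, fun i hi => ?_, fun r hr => ?_⟩
  · rw [← h i hi.le, ← h (i + 1) hi]
    exact h1 i hi
  · obtain ⟨a, b, c, -⟩ := s.valid r hr
    have := h2 r hr
    rwa [Rel.Holds, h _ a, h _ b, h _ c] at this

/-- `s'` arises from `s` by introducing new variables, without changing the solution set up to
stable equivalence, even in the presence of side conditions on the old variables. -/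
structure Ext (s s' : Sys) : Prop where
  le : s.N ≤ s'.N
  sat : ∀ {x}, s'.Sat x → s.Sat x
  seq : ∀ C, DependsUpTo s.N C →
    SEq (zeroSet s.N fun x => s.Sat x ∧ C x) (zeroSet s'.N fun x => s'.Sat x ∧ C x)

theorem Ext.refl (s : Sys) : Ext s s := ⟨le_rfl, id, fun _ _ => SEq.refl _⟩

theorem Ext.trans {s t u : Sys} (h : Ext s t) (h' : Ext t u) : Ext s u :=
  ⟨h.le.trans h'.le, fun hx => h.sat (h'.sat hx),
    fun C hC => (h.seq C hC).trans (h'.seq C (hC.mono h.le))⟩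

theorem exists_free (s : Sys) : ∃ s', Ext s s' ∧ s.N < s'.N ∧ ∀ x, s'.Sat x → x s.N < x s'.N := by
  let s' : Sys := ⟨s.N + 1, s.L, fun r hr => by
    obtain ⟨a, b, c, d⟩ := s.valid r hr
    exact ⟨by omega, by omega, by omega, d⟩⟩
  have hs : ∀ x, s'.Sat x ↔ s.Sat x ∧ x s.N < x (s.N + 1) := by
    refine fun x => ⟨fun ⟨a, b, c⟩ => ⟨⟨a, fun i hi => b i (hi.trans (Nat.lt_succ_self _)), c⟩,
      b _ (Nat.lt_succ_self _)⟩, fun ⟨⟨a, b, c⟩, d⟩ => ⟨a, fun i hi => ?_, c⟩⟩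
    rcases Nat.lt_succ_iff_lt_or_eq.1 hi with h | h
    · exact b i h
    · rw [h]
      exact d
  refine ⟨s', ⟨Nat.le_succ _, fun hx => ((hs _).1 hx).1, fun C hC => ?_⟩, Nat.lt_succ_self _,
    fun x hx => ((hs _).1 hx).2⟩
  refine SEq.of_snoc (α := Empty) (β := Unit) (s.dependsUpTo_sat.and hC) (fun _ _ _ => 0)
    (fun _ x y => y - x s.N) (fun a => a.elim)
    (fun _ => (FibreAffine.coord ()).sub (.base (polyFn_ext _))) (fun x a => ?_) (fun x _ => ?_)
  · simp only [hs, ext_snoc_last, ext_snoc_of_le _ _ le_rfl, IsEmpty.forall_iff, true_and,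
      forall_const, sub_pos]
    tauto
  · exact ⟨ext x s.N + 1, fun a => a.elim, fun _ => by simp⟩

theorem exists_rel (s : Sys) (m : Bool) {i j : ℕ} (hi : i ≤ s.N) (hj : j ≤ s.N)
    (hm : m → 1 ≤ i ∧ 1 ≤ j)
    (hlt : ∀ x, s.Sat x → x s.N < if m then x i * x j else x i + x j) :
    ∃ s', Ext s s' ∧ s.N < s'.N ∧ ∀ x, s'.Sat x →
      x s'.N = if m then x i * x j else x i + x j := by
  let s' : Sys := ⟨s.N + 1, ⟨m, i, j, s.N + 1⟩ :: s.L, by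
    rintro r hr
    rcases List.mem_cons.1 hr with rfl | hr
    · exact ⟨by simp; omega, by simp; omega, by simp, hm⟩
    · obtain ⟨a, b, c, d⟩ := s.valid r hr
      exact ⟨by omega, by omega, by omega, d⟩⟩
  have hs : ∀ x, s'.Sat x ↔ s.Sat x ∧ x (s.N + 1) = if m then x i * x j else x i + x j := by
    refine fun x => ⟨fun ⟨a, b, c⟩ => ⟨⟨a, fun i hi => b i (hi.trans (Nat.lt_succ_self _)),
      fun r hr => c r (List.mem_cons_of_mem _ hr)⟩, c _ List.mem_cons_self⟩,
      fun ⟨h, d⟩ => ⟨h.1, fun i hi => ?_, fun r hr => ?_⟩⟩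
    · rcases Nat.lt_succ_iff_lt_or_eq.1 hi with h' | h'
      · exact h.2.1 i h'
      · rw [h', d]
        exact hlt x h
    · rcases List.mem_cons.1 hr with rfl | hr
      · exact d
      · exact h.2.2 r hr
  refine ⟨s', ⟨Nat.le_succ _, fun hx => ((hs _).1 hx).1, fun C hC => ?_⟩, Nat.lt_succ_self _,
    fun x hx => ((hs _).1 hx).2⟩
  refine SEq.of_snoc (α := Unit) (β := Empty) (s.dependsUpTo_sat.and hC)
    (fun _ x y => y - if m then x i * x j else x i + x j) (fun _ _ _ => 0)
    (fun _ => (FibreAffine.coord ()).sub (.base ?_)) (fun a => a.elim)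
    (fun x a => ?_) (fun x _ => ?_)
  · split_ifs
    · exact (polyFn_ext _).mul (polyFn_ext _)
    · exact (polyFn_ext _).add (polyFn_ext _)
  · simp only [hs, ext_snoc_last, ext_snoc_of_le _ _ hi, ext_snoc_of_le _ _ hj, IsEmpty.forall_iff,
      and_true, forall_const, sub_eq_zero]
    tauto
  · exact ⟨_, fun _ => sub_self _, fun a => a.elim⟩

theorem exists_add (s : Sys) {i j : ℕ} (hi : i ≤ s.N) (hj : j ≤ s.N)
    (hlt : ∀ x, s.Sat x → x s.N < x i + x j) :
    ∃ s', Ext s s' ∧ s.N < s'.N ∧ ∀ x, s'.Sat x → x s'.N = x i + x j := by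
  simpa using s.exists_rel false hi hj (by simp) (by simpa using hlt)

theorem exists_mul (s : Sys) {i j : ℕ} (hi : i ≤ s.N) (hj : j ≤ s.N) (hi' : 1 ≤ i) (hj' : 1 ≤ j)
    (hlt : ∀ x, s.Sat x → x s.N < x i * x j) :
    ∃ s', Ext s s' ∧ s.N < s'.N ∧ ∀ x, s'.Sat x → x s'.N = x i * x j := by
  simpa using s.exists_rel true hi hj (by simp [hi', hj']) (by simpa using hlt)

/-- The difference `x b - x a` is positive and equal to `φ x` on all solutions `x` of `s`. -/
structure Repr (s : Sys) (a b : ℕ) (φ : (ℕ → ℝ) → ℝ) : Prop where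
  left_le : a ≤ s.N
  right_le : b ≤ s.N
  pos : ∀ {x}, s.Sat x → 0 < φ x
  sub_eq : ∀ {x}, s.Sat x → x b - x a = φ x

theorem Repr.ext {s s' : Sys} {a b : ℕ} {φ : (ℕ → ℝ) → ℝ} (h : Repr s a b φ) (hs : Ext s s') :
    Repr s' a b φ :=
  ⟨h.left_le.trans hs.le, h.right_le.trans hs.le, fun hx => h.pos (hs.sat hx),
    fun hx => h.sub_eq (hs.sat hx)⟩

theorem Repr.lift {s : Sys} {a b : ℕ} {φ : (ℕ → ℝ) → ℝ} (h : Repr s a b φ) :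
    ∃ s' t a', Ext s s' ∧ s.N < t ∧ t ≤ s'.N ∧ s.N < a' ∧ a' ≤ s'.N ∧ s.N < s'.N ∧
      ∀ x, s'.Sat x → x s.N < x t ∧ x a' = x t + x a ∧ x s'.N = x t + x b := by
  obtain ⟨s1, e1, n1, h1⟩ := s.exists_free
  have ha := h.left_le
  have hb := h.right_le
  obtain ⟨s2, e2, n2, h2⟩ := s1.exists_add (i := s1.N) (j := a) le_rfl (by omega) (fun x hx => by
    linarith [hx.one_le (i := a) (by omega)])
  obtain ⟨s3, e3, n3, h3⟩ := s2.exists_add (i := s1.N) (j := b) (by omega) (by omega)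
    (fun x hx => by
      rw [h2 x hx]
      linarith [h.pos (e1.sat (e2.sat hx)), h.sub_eq (e1.sat (e2.sat hx))])
  exact ⟨s3, s1.N, s2.N, (e1.trans e2).trans e3, n1, by omega, by omega, by omega, by omega,
    fun x hx => ⟨h1 x (e2.sat (e3.sat hx)), h2 x (e3.sat hx), h3 x hx⟩⟩

theorem Repr.add {s : Sys} {a b c d : ℕ} {φ ψ : (ℕ → ℝ) → ℝ} (h : Repr s a b φ)
    (h' : Repr s c d ψ) : ∃ s' e f, Ext s s' ∧ Repr s' e f (fun x => φ x + ψ x) := by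
  obtain ⟨s1, t1, a1, e1, l1, l2, l3, l4, l5, h1⟩ := h.lift
  obtain ⟨s2, t2, c2, e2, m1, m2, m3, m4, m5, h2⟩ := (h'.ext e1).lift
  have hd := h'.right_le
  obtain ⟨s3, e3, n3, h3⟩ := s2.exists_add (i := a1) (j := c2) (by omega) (by omega)
    (fun x hx => by
      obtain ⟨p1, p2, p3⟩ := h1 x (e2.sat hx)
      obtain ⟨q1, q2, q3⟩ := h2 x hx
      linarith [(e1.sat (e2.sat hx)).one_le h.left_le, (e1.sat (e2.sat hx)).one_le h'.left_le,
        (e1.sat (e2.sat hx)).le h'.right_le le_rfl])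
  obtain ⟨s4, e4, n4, h4⟩ := s3.exists_add (i := s1.N) (j := s2.N) (by omega) (by omega)
    (fun x hx => by
      obtain ⟨p1, p2, p3⟩ := h1 x (e2.sat (e3.sat hx))
      obtain ⟨q1, q2, q3⟩ := h2 x (e3.sat hx)
      have hx0 := e1.sat (e2.sat (e3.sat hx))
      linarith [h3 x hx, h.pos hx0, h.sub_eq hx0, h'.pos hx0, h'.sub_eq hx0])
  have e := (e1.trans e2).trans (e3.trans e4)
  refine ⟨s4, s3.N, s4.N, e, by omega, le_rfl, fun hx => ?_, fun {x} hx => ?_⟩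
  · exact add_pos (h.pos (e.sat hx)) (h'.pos (e.sat hx))
  · obtain ⟨p1, p2, p3⟩ := h1 x (e2.sat (e3.sat (e4.sat hx)))
    obtain ⟨q1, q2, q3⟩ := h2 x (e3.sat (e4.sat hx))
    linarith [h3 x (e4.sat hx), h4 x hx, h.sub_eq (e.sat hx), h'.sub_eq (e.sat hx)]

theorem Repr.mul {s : Sys} {a b c d : ℕ} {φ ψ : (ℕ → ℝ) → ℝ} (h : Repr s a b φ)
    (h' : Repr s c d ψ) (hφ : ∀ x, s.Sat x → 1 ≤ φ x) :
    ∃ s' e f, Ext s s' ∧ Repr s' e f (fun x => φ x * ψ x) := by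
  obtain ⟨s1, t1, a1, e1, l1, l2, l3, l4, l5, h1⟩ := h.lift
  obtain ⟨s2, e2, n2, h2⟩ := s1.exists_mul (i := s1.N) (j := s1.N) le_rfl le_rfl (by omega)
    (by omega) (fun x hx => by
      obtain ⟨p1, p2, p3⟩ := h1 x hx
      have := (e1.sat hx).one_le h.right_le
      have := (e1.sat hx).one_le le_rfl
      nlinarith)
  obtain ⟨s3, t3, c3, e3, m1, m2, m3, m4, m5, h3⟩ := (h'.ext (e1.trans e2)).lift
  have facts : ∀ x, s3.Sat x → 1 ≤ x a ∧ 1 ≤ x c ∧ 1 ≤ x b - x a ∧ 0 < x d - x c ∧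
      x d < x t1 ∧ 1 < x t1 ∧ x a1 = x t1 + x a ∧ x s1.N = x t1 + x b ∧
      x c3 = x t3 + x c ∧ x s3.N = x t3 + x d ∧ x s1.N * x s1.N < x t3 := by
    intro x hx
    have hx2 := e3.sat hx
    have hx1 := e2.sat hx2
    have hx0 := e1.sat hx1
    obtain ⟨p1, p2, p3⟩ := h1 x hx1
    obtain ⟨q1, q2, q3⟩ := h3 x hx
    have b1 := h.sub_eq hx0
    have b2 := h'.sub_eq hx0
    refine ⟨hx0.one_le h.left_le, hx0.one_le h'.left_le, b1 ▸ hφ x hx0, b2 ▸ h'.pos hx0,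
      (hx0.le h'.right_le le_rfl).trans_lt p1, (hx0.one_le le_rfl).trans_lt p1, p2, p3, q2, q3,
      by rw [← h2 x hx2]; exact q1⟩
  have prods : ∀ x, s3.Sat x → x s3.N < x a1 * x c3 ∧ x a1 * x c3 < x a1 * x s3.N ∧
      x a1 * x s3.N < x s1.N * x c3 ∧ x s1.N * x c3 < x s1.N * x s3.N ∧
      x s1.N * x s3.N < x a1 * x s3.N + x s1.N * x c3 ∧
      x a1 * x s3.N + x s1.N * x c3 < x s1.N * x s3.N + x a1 * x c3 := by
    intro x hx
    obtain ⟨f1, f2, f3, f4, f5, f6, f7, f8, f9, f10, f11⟩ := facts x hx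
    rw [f7, f9, f10]
    rw [f8] at f11 ⊢
    have g1 : (x t1 + x a) * x d < x t3 := by nlinarith
    have g2 : (x t1 + x b) * x d < x t3 := by nlinarith
    have g3 : 0 < x t1 + x a := by linarith
    have g4 : 0 < x t1 + x b := by linarith
    have g5 : 0 < x t3 := by nlinarith
    refine ⟨by nlinarith, by nlinarith, ?_, by nlinarith, ?_, by nlinarith⟩
    · nlinarith [mul_nonneg (sub_nonneg.2 f3) (show 0 ≤ x t3 + x c by linarith), mul_pos g3 (show 0 < x c by linarith)]
    · nlinarith [mul_pos g4 (show 0 < x c by linarith), mul_pos g3 g5]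
  obtain ⟨s4, e4, n4, h4⟩ := s3.exists_mul (i := a1) (j := c3) (by omega) (by omega) (by omega)
    (by omega) (fun x hx => (prods x hx).1)
  obtain ⟨s5, e5, n5, h5⟩ := s4.exists_mul (i := a1) (j := s3.N) (by omega) (by omega) (by omega)
    (by omega) (fun x hx => by rw [h4 x hx]; exact (prods x (e4.sat hx)).2.1)
  obtain ⟨s6, e6, n6, h6⟩ := s5.exists_mul (i := s1.N) (j := c3) (by omega) (by omega) (by omega)
    (by omega) (fun x hx => by rw [h5 x hx]; exact (prods x (e4.sat (e5.sat hx))).2.2.1)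
  obtain ⟨s7, e7, n7, h7⟩ := s6.exists_mul (i := s1.N) (j := s3.N) (by omega) (by omega)
    (by omega) (by omega)
    (fun x hx => by rw [h6 x hx]; exact (prods x (e4.sat (e5.sat (e6.sat hx)))).2.2.2.1)
  obtain ⟨s8, e8, n8, h8⟩ := s7.exists_add (i := s5.N) (j := s6.N) (by omega) (by omega)
    (fun x hx => by
      rw [h7 x hx, h5 x (e6.sat (e7.sat hx)), h6 x (e7.sat hx)]
      exact (prods x (e4.sat (e5.sat (e6.sat (e7.sat hx))))).2.2.2.2.1)
  obtain ⟨s9, e9, n9, h9⟩ := s8.exists_add (i := s7.N) (j := s4.N) (by omega) (by omega)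
    (fun x hx => by
      have i7 := e8.sat hx
      have i6 := e7.sat i7
      have i5 := e6.sat i6
      have i4 := e5.sat i5
      rw [h8 x hx, h7 x i7, h6 x i6, h5 x i5, h4 x i4]
      exact (prods x (e4.sat i4)).2.2.2.2.2)
  have e03 := e1.trans (e2.trans e3)
  have e39 := (e4.trans e5).trans ((e6.trans e7).trans (e8.trans e9))
  refine ⟨s9, s8.N, s9.N, e03.trans e39, by omega, le_rfl, fun {x} hx => ?_, fun {x} hx => ?_⟩
  · have hx0 := e03.sat (e39.sat hx)
    exact mul_pos (h.pos hx0) (h'.pos hx0)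
  · have i8 := e9.sat hx
    have i7 := e8.sat i8
    have i6 := e7.sat i7
    have i5 := e6.sat i6
    have i4 := e5.sat i5
    have hx0 := e03.sat (e39.sat hx)
    obtain ⟨f1, f2, f3, f4, f5, f6, f7, f8, f9, f10, f11⟩ := facts x (e4.sat i4)
    rw [h9 x hx, h8 x i8, h7 x i7, h6 x i6, h5 x i5, h4 x i4, ← h.sub_eq hx0, ← h'.sub_eq hx0,
      f7, f8, f9, f10]
    ring

theorem exists_repr_one (s : Sys) : ∃ s' e f, Ext s s' ∧ Repr s' e f (fun _ => 1) := by
  obtain ⟨s1, e1, n1, h1⟩ := s.exists_free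
  obtain ⟨s2, e2, n2, h2⟩ := s1.exists_add (i := s1.N) (j := 0) le_rfl (by omega) (fun x hx => by
    linarith [hx.1])
  exact ⟨s2, s1.N, s2.N, e1.trans e2, by omega, le_rfl, fun _ => one_pos, fun {x} hx => by
    linarith [h2 x hx, hx.1]⟩

/-- Adding a relation between existing variables. -/
theorem exists_constraint (s : Sys) {i j k : ℕ} (hi : i ≤ s.N) (hj : j ≤ s.N) (hk : k ≤ s.N) :
    ∃ s' : Sys, s'.N = s.N ∧ ∀ x, s'.Sat x ↔ s.Sat x ∧ x k = x i + x j := by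
  refine ⟨⟨s.N, ⟨false, i, j, k⟩ :: s.L, ?_⟩, rfl, fun x => ?_⟩
  · rintro r hr
    rcases List.mem_cons.1 hr with rfl | hr
    · exact ⟨hi, hj, hk, by simp⟩
    · exact s.valid r hr
  · simp only [Sat, List.forall_mem_cons, Rel.Holds, Bool.false_eq_true, if_false]
    tauto

theorem Repr.exists_eq {s : Sys} {a b c d : ℕ} {φ ψ : (ℕ → ℝ) → ℝ} (h : Repr s a b φ)
    (h' : Repr s c d ψ) : ∃ s' : Sys, s.N ≤ s'.N ∧ (∀ x, s'.Sat x → s.Sat x) ∧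
      ∀ C, DependsUpTo s.N C → SEq (zeroSet s.N fun x => s.Sat x ∧ φ x = ψ x ∧ C x)
        (zeroSet s'.N fun x => s'.Sat x ∧ C x) := by
  obtain ⟨s1, t1, a1, e1, l1, l2, l3, l4, l5, h1⟩ := h.lift
  obtain ⟨s2, t2, c2, e2, m1, m2, m3, m4, m5, h2⟩ := (h'.ext e1).lift
  have hd := h'.right_le
  obtain ⟨s3, e3, n3, h3⟩ := s2.exists_add (i := a1) (j := s2.N) (by omega) (by omega)
    (fun x hx => by
      obtain ⟨p1, p2, p3⟩ := h1 x (e2.sat hx)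
      linarith [(e1.sat (e2.sat hx)).one_le h.left_le, (e1.sat (e2.sat hx)).one_le le_rfl])
  have e := e1.trans (e2.trans e3)
  obtain ⟨s4, n4, h4⟩ := s3.exists_constraint (i := s1.N) (j := c2) (k := s3.N) (by omega)
    (by omega) le_rfl
  have h5 : ∀ x, s4.Sat x ↔ s3.Sat x ∧ x b - x a = x d - x c := by
    refine fun x => (h4 x).trans (and_congr_right fun hx => ?_)
    obtain ⟨p1, p2, p3⟩ := h1 x (e2.sat (e3.sat hx))
    obtain ⟨q1, q2, q3⟩ := h2 x (e3.sat hx)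
    rw [h3 x hx, p2, p3, q2, q3]
    constructor <;> intro <;> linarith
  refine ⟨s4, n4 ▸ e.le, fun x hx => e.sat ((h5 x).1 hx).1, fun C hC => ?_⟩
  have hD : DependsUpTo s.N fun x => x b - x a = x d - x c ∧ C x :=
    DependsUpTo.and (fun x y hxy hx => by
      rwa [← hxy _ h.left_le, ← hxy _ h.right_le, ← hxy _ h'.left_le, ← hxy _ h'.right_le]) hC
  have key := e.seq _ hD
  rw [n4]
  convert key using 2
  · funext x
    rw [eq_iff_iff]
    refine and_congr_right fun hx => ?_
    rw [h.sub_eq hx, h'.sub_eq hx]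
  · funext x
    rw [h5, and_assoc]

end Sys

/-- Subtraction-free polynomial expressions without the constant zero. -/
inductive Expr (σ : Type*)
  | var (i : σ)
  | one
  | add (F G : Expr σ)
  | mul (F G : Expr σ)

/-- The value of an expression. -/
def Expr.eval {σ : Type*} (v : σ → ℝ) : Expr σ → ℝ
  | var i => v i
  | one => 1
  | add F G => F.eval v + G.eval v
  | mul F G => F.eval v * G.eval v

theorem Expr.one_le_eval {σ : Type*} {v : σ → ℝ} (hv : ∀ i, 1 ≤ v i) (F : Expr σ) :
    1 ≤ F.eval v := by
  induction F with
  | var i => exact hv i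
  | one => exact le_rfl
  | add F G hF hG => exact hF.trans (le_add_of_nonneg_right (by linarith))
  | mul F G hF hG => exact one_le_mul_of_one_le_of_one_le hF hG

theorem Expr.exists_sub_eq_aeval {τ σ : Type*} (p q : τ → σ) (h : MvPolynomial τ ℤ) :
    ∃ F G : Expr σ, ∀ v : σ → ℝ,
      F.eval v - G.eval v = MvPolynomial.aeval (fun i => v (p i) - v (q i)) h := by
  induction h using MvPolynomial.induction_on with
  | C a =>
    induction a with
    | zero => exact ⟨one, one, fun v => by simp [Expr.eval]⟩
    | succ n ih =>
      obtain ⟨F, G, h⟩ := ih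
      refine ⟨add F one, G, fun v => ?_⟩
      have := h v
      simp only [eq_intCast, Expr.eval] at this ⊢
      push_cast at this ⊢
      simp only [map_add, map_one] at this ⊢
      linarith
    | pred n ih =>
      obtain ⟨F, G, h⟩ := ih
      refine ⟨F, add G one, fun v => ?_⟩
      have := h v
      simp only [eq_intCast, Expr.eval] at this ⊢
      push_cast at this ⊢
      simp only [map_sub, map_one] at this ⊢
      linarith
  | add f g hf hg =>
    obtain ⟨F, G, h⟩ := hf
    obtain ⟨F', G', h'⟩ := hg
    refine ⟨add F F', add G G', fun v => ?_⟩
    rw [map_add, ← h, ← h']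
    simp only [Expr.eval]
    ring
  | mul_X f i hf =>
    obtain ⟨F, G, h⟩ := hf
    refine ⟨add (mul F (var (p i))) (mul G (var (q i))),
      add (mul F (var (q i))) (mul G (var (p i))), fun v => ?_⟩
    rw [map_mul, ← h, MvPolynomial.aeval_X]
    simp only [Expr.eval]
    ring

namespace Sys

/-- `t` has at least the variables and the constraints of `s`. -/
def Refines (s t : Sys) : Prop := s.N ≤ t.N ∧ ∀ x, t.Sat x → s.Sat x

theorem Refines.trans {s t u : Sys} (h : Refines s t) (h' : Refines t u) : Refines s u :=
  ⟨h.1.trans h'.1, fun x hx => h.2 x (h'.2 x hx)⟩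

theorem Ext.refines {s t : Sys} (h : Ext s t) : Refines s t := ⟨h.le, fun _ => h.sat⟩

theorem exists_repr_eval {σ : Type*} {s : Sys} {u : σ → (ℕ → ℝ) → ℝ}
    (hu : ∀ i t, Refines s t → ∃ t' e f, Ext t t' ∧ Repr t' e f (u i))
    (hu1 : ∀ i x, s.Sat x → 1 ≤ u i x) (F : Expr σ) :
    ∀ t, Refines s t → ∃ t' e f, Ext t t' ∧ Repr t' e f (fun x => F.eval fun i => u i x) := by
  induction F with
  | var i => exact hu i
  | one => exact fun t _ => t.exists_repr_one
  | add F G hF hG =>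
    intro t ht
    obtain ⟨t1, a, b, e1, h1⟩ := hF t ht
    obtain ⟨t2, c, d, e2, h2⟩ := hG t1 (ht.trans e1.refines)
    obtain ⟨t3, e, f, e3, h3⟩ := (h1.ext e2).add h2
    exact ⟨t3, e, f, (e1.trans e2).trans e3, h3⟩
  | mul F G hF hG =>
    intro t ht
    obtain ⟨t1, a, b, e1, h1⟩ := hF t ht
    obtain ⟨t2, c, d, e2, h2⟩ := hG t1 (ht.trans e1.refines)
    obtain ⟨t3, e, f, e3, h3⟩ := (h1.ext e2).mul h2 fun x hx =>
      F.one_le_eval fun i => hu1 i x (ht.2 x (e1.sat (e2.sat hx)))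
    exact ⟨t3, e, f, (e1.trans e2).trans e3, h3⟩

theorem exists_constraints {σ : Type*} {s : Sys} {u : σ → (ℕ → ℝ) → ℝ}
    (hu : ∀ i t, Refines s t → ∃ t' e f, Ext t t' ∧ Repr t' e f (u i))
    (hu1 : ∀ i x, s.Sat x → 1 ≤ u i x)
    (hud : ∀ i (x y : ℕ → ℝ), (∀ k ≤ s.N, x k = y k) → u i x = u i y)
    (cs : List (Expr σ × Expr σ)) : ∀ t, Refines s t → ∃ t' : Sys,
      SEq (zeroSet t.N fun x => t.Sat x ∧
        ∀ c ∈ cs, c.1.eval (fun i => u i x) = c.2.eval fun i => u i x) (zeroSet t'.N t'.Sat) := by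
  induction cs with
  | nil => exact fun t _ => ⟨t, by simpa using SEq.refl _⟩
  | cons c cs ih =>
    intro t ht
    obtain ⟨t1, a, b, e1, h1⟩ := exists_repr_eval hu hu1 c.1 t ht
    obtain ⟨t2, a', b', e2, h2⟩ := exists_repr_eval hu hu1 c.2 t1 (ht.trans e1.refines)
    obtain ⟨t3, l3, i3, h3⟩ := (h1.ext e2).exists_eq h2
    have ht2 := ht.trans (e1.refines.trans e2.refines)
    obtain ⟨t4, h4⟩ := ih t3 (ht2.trans ⟨l3, i3⟩)
    have dep : ∀ cs : List (Expr σ × Expr σ), DependsUpTo s.N fun x =>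
        ∀ c ∈ cs, c.1.eval (fun i => u i x) = c.2.eval fun i => u i x := by
      intro cs x y hxy h
      simpa only [hud _ x y hxy] using h
    refine ⟨t4, (((e1.trans e2).seq _ ((dep (c :: cs)).mono ht.1)).trans ?_).trans h4⟩
    simpa only [List.forall_mem_cons] using h3 _ ((dep cs).mono ht2.1)

end Sys

/-- Partial sums translating differences of consecutive entries into entries. -/
def partialSum {σ : Type*} {n : ℕ} (e : σ ≃ Fin n) (v : σ → ℝ) (k : ℕ) : ℝ :=
  1 + ∑ j ∈ Finset.range k, if h : j < n then v (e.symm ⟨j, h⟩) - 1 else 0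

theorem ext_of_le {N k : ℕ} (x : Fin (N + 1) → ℝ) (h : k ≤ N) : ext x k = x ⟨k, by omega⟩ := by
  simp [ext, show k < N + 1 by omega]

theorem exists_sys_of_exprs {σ : Type*} [Fintype σ] (cs : List (Expr σ × Expr σ)) :
    ∃ s : Sys, SEq {v : σ → ℝ | (∀ i, 1 < v i) ∧ ∀ c ∈ cs, c.1.eval v = c.2.eval v}
      (zeroSet s.N s.Sat) := by
  obtain ⟨n, ⟨e⟩⟩ : ∃ n, Nonempty (σ ≃ Fin n) := ⟨_, ⟨Fintype.equivFin σ⟩⟩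
  let s : Sys := ⟨n, [], by simp⟩
  let u : σ → (ℕ → ℝ) → ℝ := fun i x => (x (e i + 1) - x (e i)) + 1
  have hlt : ∀ i x, s.Sat x → x (e i) < x (e i + 1) := fun i x hx => hx.2.1 _ (e i).2
  obtain ⟨t, ht⟩ := Sys.exists_constraints (s := s) (u := u) (fun i t ht => by
      have hr : t.Repr (e i) (e i + 1) (fun x => x (e i + 1) - x (e i)) :=
        ⟨(e i).2.le.trans ht.1, Nat.le_trans (e i).2 ht.1,
          fun hx => sub_pos.2 (hlt i _ (ht.2 _ hx)), fun _ => rfl⟩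
      obtain ⟨t1, a, b, e1, h1⟩ := t.exists_repr_one
      obtain ⟨t2, c, d, e2, h2⟩ := (hr.ext e1).add h1
      exact ⟨t2, c, d, e1.trans e2, h2⟩)
    (fun i x hx => by linarith [hlt i x hx])
    (fun i x y h => by simp only [u]; rw [h _ (e i).2, h _ (e i).2.le])
    cs s ⟨le_rfl, fun _ => id⟩
  refine ⟨t, SEq.trans ?_ ht⟩
  have hA : ∀ v, ∀ k ≤ n, ext (fun k : Fin (n + 1) => partialSum e v k) k = partialSum e v k :=
    fun v k hk => ext_of_le _ hk
  have hu : ∀ v i, u i (ext fun k : Fin (n + 1) => partialSum e v k) = v i := by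
    intro v i
    simp only [u]
    rw [hA v _ (e i).2, hA v _ (e i).2.le]
    simp [partialSum, Finset.sum_range_succ]
  refine SEq.of_ratOn (fun v k => partialSum e v k) (fun x i => u i (ext x)) ?_ ?_ ?_ ?_ ?_ ?_
  · intro k
    refine ((PolyFn.const 1).add (PolyFn.sum _ fun j _ => ?_)).ratOn _
    split_ifs
    · exact (PolyFn.coord _).sub (.const 1)
    · exact .const 0
  · exact fun i => (((polyFn_ext _).sub (polyFn_ext _)).add (.const 1)).ratOn _
  · rintro v ⟨hv, hc⟩
    refine ⟨⟨?_, fun i hi => ?_, by simp [s]⟩, fun c hc' => ?_⟩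
    · rw [hA v 0 (Nat.zero_le _)]
      simp [partialSum]
    · rw [hA v i hi.le, hA v _ hi]
      have hi' : i < n := hi
      simp only [partialSum, Finset.sum_range_succ, hi', dite_true]
      linarith [hv (e.symm ⟨i, hi⟩)]
    · have : (fun i => u i (ext fun k : Fin (n + 1) => partialSum e v k)) = v := funext (hu v)
      change c.1.eval (fun i => u i (ext fun k : Fin (n + 1) => partialSum e v k)) =
        c.2.eval fun i => u i (ext fun k : Fin (n + 1) => partialSum e v k)
      rw [this]
      exact hc c hc'
  · rintro x ⟨hx, hc⟩
    refine ⟨fun i => ?_, hc⟩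
    linarith [hlt i _ hx]
  · exact fun v _ => funext (hu v)
  · rintro x ⟨hx, -⟩
    have : ∀ k ≤ n, partialSum e (fun i => u i (ext x)) k = ext x k := by
      intro k hk
      induction k with
      | zero => simpa [partialSum] using hx.1.symm
      | succ k ih =>
        have hk' : k < n := hk
        have := ih hk'.le
        simp only [partialSum, Finset.sum_range_succ, hk', dite_true] at this ⊢
        simp only [u, Equiv.apply_symm_apply] at this ⊢
        linarith
    funext k
    rw [this k (Nat.lt_succ_iff.1 k.2), ext_of_le _ (Nat.lt_succ_iff.1 k.2)]

theorem polyFn_aeval {ι : Type*} (p : MvPolynomial ι ℤ) :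
    PolyFn (fun x : ι → ℝ => MvPolynomial.aeval x p) :=
  ⟨MvPolynomial.map (Int.castRingHom ℝ) p, fun x => by
    change MvPolynomial.aeval x p = _
    rw [MvPolynomial.eval_map, MvPolynomial.aeval_def]
    rfl⟩

theorem exists_sys {m : ℕ} {V : Set (Fin m → ℝ)} (hV : IsPrimaryBasicSemialgebraicZ V) :
    ∃ s : Sys, SEq V (zeroSet s.N s.Sat) := by
  obtain ⟨k, l, f, g, rfl⟩ := hV
  let σ := (Fin m × Bool) ⊕ (Fin l × Bool)
  let p : Fin m → σ := fun i => .inl (i, true)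
  let q : Fin m → σ := fun i => .inl (i, false)
  choose F G hFG using fun h : MvPolynomial (Fin m) ℤ => Expr.exists_sub_eq_aeval p q h
  obtain ⟨s, hs⟩ := exists_sys_of_exprs
    (List.ofFn (fun i => (F (f i), G (f i))) ++ List.ofFn (fun j =>
      ((F (g j)).mul (.var (.inr (j, false))),
        ((G (g j)).mul (.var (.inr (j, false)))).add (.var (.inr (j, true))))))
  refine ⟨s, SEq.trans ?_ hs⟩
  simp only [List.forall_mem_append, List.forall_mem_ofFn_iff, Expr.eval]
  let L : Fin m ⊕ Fin l → (Fin m → ℝ) → (σ → ℝ) → ℝ := fun a x y => a.elim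
    (fun i => y (p i) - y (q i) - x i)
    (fun j => y (.inr (j, true)) - MvPolynomial.aeval x (g j) * y (.inr (j, false)))
  let M : σ → (Fin m → ℝ) → (σ → ℝ) → ℝ := fun i x y => y i - 1
  refine (SEq.of_fibre (T := {z | (fun i => z (.inl i)) ∈ _ ∧
    (∀ a, L a (fun i => z (.inl i)) (fun i => z (.inr i)) = 0) ∧
    ∀ b, 0 < M b (fun i => z (.inl i)) (fun i => z (.inr i))}) L M ?_ ?_
    (fun x y => Iff.rfl) ?_).trans ?_
  · rintro (i | j)
    · exact ((FibreAffine.coord _).sub (.coord _)).sub (.base (.coord i))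
    · exact (FibreAffine.coord _).sub (.smul (polyFn_aeval _) (.coord _))
  · exact fun i => (FibreAffine.coord i).sub (.base (.const 1))
  · rintro x ⟨-, hg⟩
    refine ⟨Sum.elim (fun i => if i.2 then x i.1 + (2 + |x i.1|) else 2 + |x i.1|)
      (fun j => if j.2 then 2 * MvPolynomial.aeval x (g j.1) + 2
        else 2 + 2 / MvPolynomial.aeval x (g j.1)), ?_, ?_⟩
    · rintro (i | j)
      · simp [L, p, q]
      · have := (hg j).ne'
        simp only [L, Sum.elim_inr]
        simp
        field_simp
        ring
    · rintro (⟨i, b⟩ | ⟨j, b⟩)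
      · have := neg_abs_le (x i)
        have := abs_nonneg (x i)
        cases b <;> simp [M] <;> linarith
      · have h1 := hg j
        have := div_pos two_pos h1
        cases b <;> simp [M] <;> linarith
  · refine SEq.of_ratOn (fun z i => z (.inr i))
      (fun v => Sum.elim (fun i => v (p i) - v (q i)) v)
      (fun _ => .coord _) ?_ ?_ ?_ ?_ (fun _ _ => rfl)
    · rintro (i | i)
      · exact (RatOn.coord _).sub (.coord _)
      · exact .coord _
    · rintro z ⟨⟨hf, hg⟩, hL, hM⟩
      have hx : (fun i => z (.inr (p i)) - z (.inr (q i))) = fun i => z (.inl i) := by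
        funext i
        have := hL (.inl i)
        simp only [L, Sum.elim_inl] at this
        linarith
      have hFG' := fun h => hFG h (fun i => z (.inr i))
      simp only [hx] at hFG'
      refine ⟨fun i => by have := hM i; simp only [M] at this; linarith, fun i => ?_, fun j => ?_⟩
      · exact sub_eq_zero.1 ((hFG' _).trans (hf i))
      · have := hL (.inr j)
        simp only [L, Sum.elim_inr] at this
        rw [← hFG'] at this
        linarith
    · rintro v ⟨h1, hf, hg⟩
      have hw : ∀ j, v (.inr (j, true)) = MvPolynomial.aeval (fun i => v (p i) - v (q i)) (g j) *
          v (.inr (j, false)) := fun j => by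
        rw [← hFG]
        linarith [hg j]
      refine ⟨⟨fun i => ?_, fun j => ?_⟩, ?_, fun i => sub_pos.2 (h1 i)⟩
      · change MvPolynomial.aeval (fun i => v (p i) - v (q i)) (f i) = 0
        rw [← hFG]
        exact sub_eq_zero.2 (hf i)
      · change 0 < MvPolynomial.aeval (fun i => v (p i) - v (q i)) (g j)
        have h2 := h1 (.inr (j, false))
        have h3 := h1 (.inr (j, true))
        rw [hw] at h3
        exact pos_of_mul_pos_left (by linarith) (by linarith : (0 : ℝ) ≤ v (.inr (j, false)))
      · rintro (i | j)
        · simp [L]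
        · simp only [L, Sum.elim_inr, Sum.elim_inl]
          rw [hw]
          exact sub_self _
    · rintro z ⟨-, hL, -⟩
      funext i
      rcases i with i | i
      · have := hL (.inl i)
        simp only [L, Sum.elim_inl] at this ⊢
        linarith
      · rfl

open SignType

/-- The values of the linear functional `a` on the standard basis vectors and on the rows of the
matrix `x`. -/
def value {I J : Type*} [Fintype I] (x : J × I → ℝ) (a : I → ℝ) : I ⊕ J → ℝ :=
  Sum.elim a fun j => ∑ k, x (j, k) * a k

/-- Every covector of the vector configuration `x` is a covector of `y`. -/
def CovLE {I J : Type*} [Fintype I] (x y : J × I → ℝ) : Prop :=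
  ∀ a, ∃ b, ∀ e, sign (value x a e) = sign (value y b e)

/-- The set of configurations realizing the same oriented matroid as `x₀`. -/
def oriented {I J : Type*} [Fintype I] (x₀ : J × I → ℝ) : Set (J × I → ℝ) :=
  {x | CovLE x₀ x ∧ CovLE x x₀}

theorem CovLE.sign_eq {I J : Type*} [Fintype I] [DecidableEq I] {x y : J × I → ℝ}
    (h : CovLE x y) (j : J) (k : I) : sign (x (j, k)) = sign (y (j, k)) := by
  obtain ⟨b, hb⟩ := h (Pi.single k 1)
  have h0 : ∀ l, l ≠ k → b l = 0 := fun l hl => by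
    have := hb (.inl l)
    rw [eq_comm] at this
    simpa [value, hl] using this
  have h1 : 0 < b k := by
    have := hb (.inl k)
    simpa [value, eq_comm (a := (1 : SignType)), sign_eq_one_iff] using this
  have h2 := hb (.inr j)
  simp only [value, Sum.elim_inr, Pi.single_apply, mul_ite, mul_one, mul_zero,
    Finset.sum_ite_eq', Finset.mem_univ, if_true] at h2
  rw [h2, Finset.sum_eq_single k (fun l _ hl => by rw [h0 l hl, mul_zero]) (by simp), sign_mul,
    sign_pos h1, mul_one]

theorem sign_pos_mul {c : ℝ} (hc : 0 < c) (x : ℝ) : sign (c * x) = sign x := by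
  rw [sign_mul, sign_pos hc, one_mul]

theorem exists_shift {ι : Type*} [Finite ι] {τ τ' : ι → ℝ}
    (h : ∀ a b, sign (τ a - τ b) = sign (τ' a - τ' b)) (r : ℝ) :
    ∃ r', ∀ a, sign (r + τ a) = sign (r' + τ' a) := by
  classical
  cases nonempty_fintype ι
  by_cases h0 : ∃ a, r + τ a = 0
  · obtain ⟨a, ha⟩ := h0
    refine ⟨-τ' a, fun b => ?_⟩
    rw [show r + τ b = τ b - τ a by linarith, h]
    congr 1
    ring
  · push Not at h0
    obtain ⟨m, h1, h2⟩ := Order.exists_between_finsets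
      (Finset.univ.filter (fun a => 0 < r + τ a) |>.image fun a => -τ' a)
      (Finset.univ.filter (fun a => r + τ a < 0) |>.image fun a => -τ' a) (by
        simp only [Finset.mem_image, Finset.mem_filter, Finset.mem_univ, true_and]
        rintro _ ⟨a, ha, rfl⟩ _ ⟨b, hb, rfl⟩
        have : sign (τ' a - τ' b) = 1 := by
          rw [← h, sign_eq_one_iff]
          linarith
        rw [sign_eq_one_iff] at this
        linarith)
    refine ⟨m, fun a => ?_⟩
    rcases lt_trichotomy (r + τ a) 0 with h3 | h3 | h3
    · have := h2 (-τ' a) (Finset.mem_image_of_mem _ (by simpa using h3))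
      rw [sign_neg h3, sign_neg (by linarith)]
    · exact absurd h3 (h0 a)
    · have := h1 (-τ' a) (Finset.mem_image_of_mem _ (by simpa using h3))
      rw [sign_pos h3, sign_pos (by linarith)]

theorem exists_shift_of_three {v v' : Fin 3 → ℝ} (h0 : ∀ b, sign (v b) = sign (v' b))
    (h1 : sign (v 1 - v 0) = sign (v' 1 - v' 0)) (h2 : sign (v 2 - v 0) = sign (v' 2 - v' 0))
    (h3 : sign (v 2 - v 1) = sign (v' 2 - v' 1)) (r : ℝ) :
    ∃ r', sign r = sign r' ∧ ∀ b, sign (r + v b) = sign (r' + v' b) := by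
  have hneg : ∀ {a b c d : ℝ}, sign (a - b) = sign (c - d) → sign (b - a) = sign (d - c) := by
    intro a b c d h
    rw [← neg_sub a, ← neg_sub c, Left.sign_neg, Left.sign_neg, h]
  obtain ⟨r', hr⟩ := exists_shift (τ := (fun b : Option (Fin 3) => b.elim 0 v))
    (τ' := (fun b : Option (Fin 3) => b.elim 0 v')) (by
      have h0' : ∀ b, sign (0 - v b) = sign (0 - v' b) := fun b =>
        hneg (by simpa using h0 b)
      rintro (_ | a) (_ | b)
      · simp
      · exact h0' b
      · simpa using h0 a
      · simp only [Option.elim_some]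
        fin_cases a <;> fin_cases b
        · simp
        · exact hneg h1
        · exact hneg h2
        · exact h1
        · simp
        · exact hneg h3
        · exact h2
        · exact h3
        · simp) r
  exact ⟨r', by simpa using hr none, fun b => hr (some b)⟩

/-- Shor systems, with the relations indexed by `Fin g`. -/
structure Shor where
  n : ℕ
  g : ℕ
  isMul : Fin g → Bool
  i : Fin g → Fin (n + 1)
  j : Fin g → Fin (n + 1)
  k : Fin g → Fin (n + 1)
  ne_zero : ∀ c, isMul c → i c ≠ 0 ∧ j c ≠ 0

namespace Shor

variable (M : Shor)

/-- The solutions of a Shor system. -/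
def sol : Set (Fin (M.n + 1) → ℝ) :=
  {x | x 0 = 1 ∧ StrictMono x ∧ ∀ c,
    x (M.k c) = if M.isMul c then x (M.i c) * x (M.j c) else x (M.i c) + x (M.j c)}

/-- Coordinates: the two points spanning the line at infinity, and an origin for each gadget. -/
abbrev Col : Type := Fin 2 ⊕ Fin M.g

/-- Further points: the slopes, and three more points for each gadget. -/
abbrev Row : Type := Fin (M.n + 1) ⊕ Fin M.g × Fin 3

/-- Parameters of a realization in addition to a solution: scaling factors `α` of slopes, the
unit slope `ρ`, scaling factors `μ` of points and sizes `l` of gadgets. -/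
abbrev Par : Type := Fin (M.n + 1) ⊕ Unit ⊕ (Fin M.g × Fin 3) ⊕ Fin M.g

/-- First coordinates of the points of a gadget. -/
def fstCoord (x : Fin (M.n + 1) → ℝ) (c : Fin M.g) : Fin 3 → ℝ :=
  if M.isMul c then ![1 - 1 / x (M.i c), 1, 1] else ![0, 1, 1]

/-- Second coordinates of the points of a gadget. -/
def sndCoord (x : Fin (M.n + 1) → ℝ) (c : Fin M.g) : Fin 3 → ℝ :=
  if M.isMul c then ![0, 1, x (M.j c)] else ![x (M.j c), x (M.j c), x (M.i c) + x (M.j c)]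

/-- The vector configuration attached to a solution `x` and to parameters `p`. -/
def conf (x : Fin (M.n + 1) → ℝ) (p : M.Par → ℝ) : M.Row × M.Col → ℝ
  | (.inl i, .inl b) => if b = 0 then p (.inl i) else p (.inl i) * p (.inr (.inl ())) * x i
  | (.inl _, .inr _) => 0
  | (.inr (c, b), .inl d) =>
      p (.inr (.inr (.inl (c, b)))) * p (.inr (.inr (.inr c))) *
        if d = 0 then M.fstCoord x c b else p (.inr (.inl ())) * M.sndCoord x c b
  | (.inr (c, b), .inr c') => if c' = c then p (.inr (.inr (.inl (c, b)))) else 0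

variable {M}

theorem value_slope {x : M.Row × M.Col → ℝ} {i : Fin (M.n + 1)} (h : ∀ c, x (.inl i, .inr c) = 0)
    (a : M.Col → ℝ) : value x a (.inr (.inl i)) =
      x (.inl i, .inl 0) * a (.inl 0) + x (.inl i, .inl 1) * a (.inl 1) := by
  simp [value, Fintype.sum_sum_type, h]

theorem value_point {x : M.Row × M.Col → ℝ} {c : Fin M.g} {b : Fin 3}
    (h : ∀ c', c' ≠ c → x (.inr (c, b), .inr c') = 0) (a : M.Col → ℝ) :
    value x a (.inr (.inr (c, b))) = x (.inr (c, b), .inl 0) * a (.inl 0) +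
      x (.inr (c, b), .inl 1) * a (.inl 1) + x (.inr (c, b), .inr c) * a (.inr c) := by
  simp only [value, Sum.elim_inr, Fintype.sum_sum_type, Fin.sum_univ_two]
  rw [Finset.sum_eq_single c (fun c' _ hc => by rw [h c' hc, zero_mul]) (by simp)]

theorem value_conf_slope (x : Fin (M.n + 1) → ℝ) (p : M.Par → ℝ) (a : M.Col → ℝ)
    (i : Fin (M.n + 1)) : value (M.conf x p) a (.inr (.inl i)) =
      p (.inl i) * (a (.inl 0) + p (.inr (.inl ())) * x i * a (.inl 1)) := by
  rw [value_slope fun _ => rfl]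
  simp only [conf, one_ne_zero, if_true, if_false]
  ring

theorem value_conf_point (x : Fin (M.n + 1) → ℝ) (p : M.Par → ℝ) (a : M.Col → ℝ)
    (c : Fin M.g) (b : Fin 3) : value (M.conf x p) a (.inr (.inr (c, b))) =
      p (.inr (.inr (.inl (c, b)))) * (a (.inr c) + p (.inr (.inr (.inr c))) *
        (M.fstCoord x c b * a (.inl 0) + p (.inr (.inl ())) * M.sndCoord x c b * a (.inl 1))) := by
  rw [value_point fun c' h => if_neg h]
  simp only [conf, one_ne_zero, if_true, if_false]
  ring

theorem one_le_of_mem_sol {x : Fin (M.n + 1) → ℝ} (hx : x ∈ M.sol) (i : Fin (M.n + 1)) :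
    1 ≤ x i := hx.1 ▸ hx.2.1.monotone (Fin.zero_le i)

theorem one_lt_of_mem_sol {x : Fin (M.n + 1) → ℝ} (hx : x ∈ M.sol) {i : Fin (M.n + 1)}
    (hi : i ≠ 0) : 1 < x i := hx.1 ▸ hx.2.1 (Fin.pos_of_ne_zero hi)

theorem sndCoord_fstCoord_sign {x x' : Fin (M.n + 1) → ℝ} (hx : x ∈ M.sol) (hx' : x' ∈ M.sol)
    {r r' a0 a1 b0 b1 : ℝ} (hr : 0 < r) (hr' : 0 < r') (h0 : sign a0 = sign b0)
    (h1 : sign a1 = sign b1)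
    (hs : ∀ i, sign (a0 + r * x i * a1) = sign (b0 + r' * x' i * b1)) (c : Fin M.g) :
    let v := fun b => M.fstCoord x c b * a0 + r * M.sndCoord x c b * a1
    let v' := fun b => M.fstCoord x' c b * b0 + r' * M.sndCoord x' c b * b1
    (∀ b, sign (v b) = sign (v' b)) ∧ sign (v 1 - v 0) = sign (v' 1 - v' 0) ∧
      sign (v 2 - v 0) = sign (v' 2 - v' 0) ∧ sign (v 2 - v 1) = sign (v' 2 - v' 1) := by
  have p : ∀ i, 0 < x i := fun i => one_pos.trans_le (one_le_of_mem_sol hx i)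
  have p' : ∀ i, 0 < x' i := fun i => one_pos.trans_le (one_le_of_mem_sol hx' i)
  have hk := hx.2.2 c
  have hk' := hx'.2.2 c
  have scale : ∀ {u w u' w' e e' : ℝ}, sign w = sign w' → 0 < e → 0 < e' → u = e * w →
      u' = e' * w' → sign u = sign u' := by
    rintro u w u' w' e e' h he he' rfl rfl
    rw [sign_pos_mul he, sign_pos_mul he', h]
  have hi := p (M.i c)
  have hi' := p' (M.i c)
  have hj := p (M.j c)
  have hj' := p' (M.j c)
  by_cases hm : M.isMul c
  · simp only [hm, if_true] at hk hk'
    obtain ⟨n1, n2⟩ := M.ne_zero c hm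
    have li := one_lt_of_mem_sol hx n1
    have li' := one_lt_of_mem_sol hx' n1
    have lj := one_lt_of_mem_sol hx n2
    have lj' := one_lt_of_mem_sol hx' n2
    have s0 := hs 0
    rw [hx.1, hx'.1] at s0
    have q : 0 < 1 - 1 / x (M.i c) := by
      rw [sub_pos, div_lt_one hi]
      exact li
    have q' : 0 < 1 - 1 / x' (M.i c) := by
      rw [sub_pos, div_lt_one hi']
      exact li'
    have d := one_div_pos.2 hi
    have d' := one_div_pos.2 hi'
    have e := mul_pos hr (sub_pos.2 lj)
    have e' := mul_pos hr' (sub_pos.2 lj')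
    simp only [fstCoord, sndCoord, hm, if_true, Fin.forall_fin_succ, IsEmpty.forall_iff, and_true]
    refine ⟨⟨?_, ?_, ?_⟩, ?_, ?_, ?_⟩
    · refine scale h0 q q' ?_ ?_ <;> simp
    · refine scale s0 one_pos one_pos ?_ ?_ <;> simp
    · refine scale (hs (M.j c)) one_pos one_pos ?_ ?_ <;> simp
    · refine scale (hs (M.i c)) d d' ?_ ?_ <;> simp <;> field_simp <;> ring
    · refine scale (hs (M.k c)) d d' ?_ ?_
      · rw [hk]
        simp
        field_simp
        ring
      · rw [hk']
        simp
        field_simp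
        ring
    · refine scale h1 e e' ?_ ?_ <;> simp <;> ring
  · simp only [hm] at hk hk'
    simp only [Bool.false_eq_true, if_false] at hk hk'
    simp only [fstCoord, sndCoord, hm, Fin.forall_fin_succ, IsEmpty.forall_iff, and_true]
    refine ⟨⟨?_, ?_, ?_⟩, ?_, ?_, ?_⟩
    · refine scale h1 (mul_pos hr hj) (mul_pos hr' hj') ?_ ?_ <;> simp
    · refine scale (hs (M.j c)) one_pos one_pos ?_ ?_ <;> simp
    · refine scale (hs (M.k c)) one_pos one_pos ?_ ?_
      · rw [hk]
        simp
      · rw [hk']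
        simp
    · refine scale h0 one_pos one_pos ?_ ?_ <;> simp
    · refine scale (hs (M.i c)) one_pos one_pos ?_ ?_ <;> simp <;> ring
    · refine scale h1 (mul_pos hr hi) (mul_pos hr' hi') ?_ ?_ <;> simp <;> ring

theorem exists_sign_slopes {x x' : Fin (M.n + 1) → ℝ} (hx : x ∈ M.sol) (hx' : x' ∈ M.sol)
    {r r' : ℝ} (hr : 0 < r) (hr' : 0 < r') (a0 a1 : ℝ) :
    ∃ b0 b1, sign a0 = sign b0 ∧ sign a1 = sign b1 ∧
      ∀ i, sign (a0 + r * x i * a1) = sign (b0 + r' * x' i * b1) := by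
  rcases eq_or_ne a1 0 with rfl | h1
  · exact ⟨a0, 0, rfl, rfl, fun i => by simp⟩
  · have p : ∀ i, 0 < x i := fun i => one_pos.trans_le (one_le_of_mem_sol hx i)
    have p' : ∀ i, 0 < x' i := fun i => one_pos.trans_le (one_le_of_mem_sol hx' i)
    obtain ⟨m, hm⟩ := exists_shift (τ := fun o : Option (Fin (M.n + 1)) => o.elim 0 x)
      (τ' := fun o : Option (Fin (M.n + 1)) => o.elim 0 x') (by
        rintro (_ | a) (_ | b)
        · simp
        · simp [sign_neg, p, p']
        · simp [sign_pos, p, p']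
        · simp only [Option.elim_some]
          rcases lt_trichotomy a b with h | rfl | h
          · rw [sign_neg (sub_neg.2 (hx.2.1 h)), sign_neg (sub_neg.2 (hx'.2.1 h))]
          · simp
          · rw [sign_pos (sub_pos.2 (hx.2.1 h)), sign_pos (sub_pos.2 (hx'.2.1 h))])
      (a0 / (r * a1))
    have e : a0 = r * ((a0 / (r * a1) + 0) * a1) := by
      field_simp
      simp
    refine ⟨r' * ((m + 0) * a1), a1, ?_, rfl, fun i => ?_⟩
    · rw [e, sign_pos_mul hr, sign_pos_mul hr', sign_mul, sign_mul]
      congr 1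
      exact hm none
    · rw [show a0 + r * x i * a1 = r * ((a0 / (r * a1) + x i) * a1) by field_simp,
        show r' * ((m + 0) * a1) + r' * x' i * a1 = r' * ((m + x' i) * a1) by ring,
        sign_pos_mul hr, sign_pos_mul hr', sign_mul, sign_mul]
      congr 1
      exact hm (some i)

theorem covLE_conf {x x' : Fin (M.n + 1) → ℝ} (hx : x ∈ M.sol) (hx' : x' ∈ M.sol)
    {p p' : M.Par → ℝ} (hp : ∀ b, 0 < p b) (hp' : ∀ b, 0 < p' b) :
    CovLE (M.conf x p) (M.conf x' p') := by
  intro a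
  obtain ⟨b0, b1, h0, h1, hs⟩ := exists_sign_slopes hx hx' (hp (.inr (.inl ())))
    (hp' (.inr (.inl ()))) (a (.inl 0)) (a (.inl 1))
  have key : ∀ c, ∃ r', sign (a (.inr c)) = sign r' ∧ ∀ b,
      sign (a (.inr c) + p (.inr (.inr (.inr c))) * (M.fstCoord x c b * a (.inl 0) +
        p (.inr (.inl ())) * M.sndCoord x c b * a (.inl 1))) =
      sign (r' + p' (.inr (.inr (.inr c))) * (M.fstCoord x' c b * b0 +
        p' (.inr (.inl ())) * M.sndCoord x' c b * b1)) := by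
    intro c
    obtain ⟨k0, k1, k2, k3⟩ := sndCoord_fstCoord_sign hx hx' (hp (.inr (.inl ())))
      (hp' (.inr (.inl ()))) h0 h1 hs c
    have hl := hp (.inr (.inr (.inr c)))
    have hl' := hp' (.inr (.inr (.inr c)))
    refine exists_shift_of_three (v := fun b => _ * _) (v' := fun b => _ * _) ?_ ?_ ?_ ?_ _
    · intro b
      rw [sign_pos_mul hl, sign_pos_mul hl', k0]
    all_goals
      rw [← mul_sub, ← mul_sub, sign_pos_mul hl, sign_pos_mul hl']
      assumption
  choose r hr hr' using key
  refine ⟨Sum.elim ![b0, b1] r, ?_⟩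
  rintro ((b | c) | (i | ⟨c, b⟩))
  · fin_cases b
    · exact h0
    · exact h1
  · exact hr c
  · rw [value_conf_slope, value_conf_slope, sign_pos_mul (hp _), sign_pos_mul (hp' _)]
    exact hs i
  · rw [value_conf_point, value_conf_point, sign_pos_mul (hp _), sign_pos_mul (hp' _)]
    exact hr' c b

/-- The slope of a point at infinity. -/
def slope (x : M.Row × M.Col → ℝ) (i : Fin (M.n + 1)) : ℝ :=
  x (.inl i, .inl 1) / x (.inl i, .inl 0)

/-- The affine coordinates of a point of a gadget. -/
def affCoord (x : M.Row × M.Col → ℝ) (d : Fin 2) (c : Fin M.g) (b : Fin 3) : ℝ :=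
  x (.inr (c, b), .inl d) / x (.inr (c, b), .inr c)

/-- The solution encoded by a vector configuration. -/
def toSol (x : M.Row × M.Col → ℝ) (i : Fin (M.n + 1)) : ℝ := slope x i / slope x 0

/-- The parameters of a vector configuration. -/
def toPar (x : M.Row × M.Col → ℝ) : M.Par → ℝ
  | .inl i => x (.inl i, .inl 0)
  | .inr (.inl ()) => slope x 0
  | .inr (.inr (.inl (c, b))) => x (.inr (c, b), .inr c)
  | .inr (.inr (.inr c)) => affCoord x 0 c 2

theorem fstCoord_two (x : Fin (M.n + 1) → ℝ) (c : Fin M.g) : M.fstCoord x c 2 = 1 := by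
  unfold fstCoord
  split_ifs <;> rfl

theorem slope_conf {x : Fin (M.n + 1) → ℝ} {p : M.Par → ℝ} (hp : ∀ b, 0 < p b)
    (i : Fin (M.n + 1)) : slope (M.conf x p) i = p (.inr (.inl ())) * x i := by
  have := (hp (.inl i)).ne'
  simp only [slope, conf, one_ne_zero, if_true, if_false]
  field_simp

theorem toSol_conf {x : Fin (M.n + 1) → ℝ} (hx : x ∈ M.sol) {p : M.Par → ℝ}
    (hp : ∀ b, 0 < p b) : toSol (M.conf x p) = x := by
  funext i
  have := (hp (.inr (.inl ()))).ne'
  rw [toSol, slope_conf hp, slope_conf hp, hx.1]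
  field_simp

theorem toPar_conf {x : Fin (M.n + 1) → ℝ} (hx : x ∈ M.sol) {p : M.Par → ℝ}
    (hp : ∀ b, 0 < p b) : toPar (M.conf x p) = p := by
  funext b
  rcases b with i | ⟨⟩ | ⟨c, b⟩ | c
  · simp [toPar, conf]
  · rw [toPar, slope_conf hp, hx.1, mul_one]
  · simp [toPar, conf]
  · have := (hp (.inr (.inr (.inl (c, 2))))).ne'
    simp only [toPar, affCoord, conf, if_true, fstCoord_two]
    field_simp

section Backward

variable {x₀ : Fin (M.n + 1) → ℝ} {p₀ : M.Par → ℝ} {x : M.Row × M.Col → ℝ}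

theorem slope_entries_pos (hx₀ : x₀ ∈ M.sol) (hp₀ : ∀ b, 0 < p₀ b) (h : CovLE (M.conf x₀ p₀) x)
    (i : Fin (M.n + 1)) (d : Fin 2) : 0 < x (.inl i, .inl d) := by
  rw [← sign_eq_one_iff, ← h.sign_eq, sign_eq_one_iff]
  simp only [conf]
  split_ifs
  · exact hp₀ _
  · exact mul_pos (mul_pos (hp₀ _) (hp₀ _)) (one_pos.trans_le (one_le_of_mem_sol hx₀ i))

theorem slope_gadget_eq_zero (h : CovLE (M.conf x₀ p₀) x)
    (i : Fin (M.n + 1)) (c : Fin M.g) : x (.inl i, .inr c) = 0 := by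
  rw [← sign_eq_zero_iff, ← h.sign_eq]
  simp [conf]

theorem point_gadget_eq_zero (h : CovLE (M.conf x₀ p₀) x)
    (c : Fin M.g) (b : Fin 3) {c' : Fin M.g} (hc : c' ≠ c) : x (.inr (c, b), .inr c') = 0 := by
  rw [← sign_eq_zero_iff, ← h.sign_eq]
  simp [conf, hc]

theorem point_gadget_pos (hp₀ : ∀ b, 0 < p₀ b) (h : CovLE (M.conf x₀ p₀) x)
    (c : Fin M.g) (b : Fin 3) : 0 < x (.inr (c, b), .inr c) := by
  rw [← sign_eq_one_iff, ← h.sign_eq, sign_eq_one_iff]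
  simpa [conf] using hp₀ _

theorem affCoord_two_pos (hp₀ : ∀ b, 0 < p₀ b) (h : CovLE (M.conf x₀ p₀) x)
    (c : Fin M.g) : 0 < affCoord x 0 c 2 := by
  refine div_pos ?_ (point_gadget_pos hp₀ h c 2)
  rw [← sign_eq_one_iff, ← h.sign_eq, sign_eq_one_iff]
  simp only [conf, if_true, fstCoord_two, mul_one]
  exact mul_pos (hp₀ _) (hp₀ _)

theorem slope_pos (hx₀ : x₀ ∈ M.sol) (hp₀ : ∀ b, 0 < p₀ b) (h : CovLE (M.conf x₀ p₀) x)
    (i : Fin (M.n + 1)) : 0 < slope x i :=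
  div_pos (slope_entries_pos hx₀ hp₀ h i 1) (slope_entries_pos hx₀ hp₀ h i 0)

theorem sign_value_slope (hx₀ : x₀ ∈ M.sol) (hp₀ : ∀ b, 0 < p₀ b) (h : CovLE (M.conf x₀ p₀) x)
    (a : M.Col → ℝ) (i : Fin (M.n + 1)) : sign (value x a (.inr (.inl i))) =
      sign (a (.inl 0) + slope x i * a (.inl 1)) := by
  have h0 := slope_entries_pos hx₀ hp₀ h i 0
  rw [value_slope (slope_gadget_eq_zero h i),
    ← sign_pos_mul h0 (a (.inl 0) + slope x i * a (.inl 1))]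
  congr 1
  simp only [slope]
  field_simp

theorem sign_value_point (hp₀ : ∀ b, 0 < p₀ b) (h : CovLE (M.conf x₀ p₀) x)
    (a : M.Col → ℝ) (c : Fin M.g) (b : Fin 3) : sign (value x a (.inr (.inr (c, b)))) =
      sign (a (.inr c) + affCoord x 0 c b * a (.inl 0) + affCoord x 1 c b * a (.inl 1)) := by
  have h0 := point_gadget_pos hp₀ h c b
  rw [value_point fun c' hc => point_gadget_eq_zero h c b hc,
    ← sign_pos_mul h0 (a (.inr c) + affCoord x 0 c b * a (.inl 0) + affCoord x 1 c b * a (.inl 1))]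
  congr 1
  simp only [affCoord]
  field_simp
  ring

/-- Transfer of a covector with prescribed values on the line at infinity. -/
theorem exists_transfer (hx₀ : x₀ ∈ M.sol) (hp₀ : ∀ b, 0 < p₀ b) (h : CovLE (M.conf x₀ p₀) x)
    (a0 a1 t : ℝ) : ∃ b0 b1, sign a0 = sign b0 ∧ sign a1 = sign b1 ∧
      (∀ i, sign (a0 + p₀ (.inr (.inl ())) * x₀ i * a1) = sign (b0 + slope x i * b1)) ∧
      ∀ c, ∃ s, (t = 0 → s = 0) ∧ ∀ b, M.fstCoord x₀ c b * a0 +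
          p₀ (.inr (.inl ())) * M.sndCoord x₀ c b * a1 = t →
        affCoord x 0 c b * b0 + affCoord x 1 c b * b1 = s := by
  obtain ⟨b, hb⟩ := h (Sum.elim ![a0, a1] fun c => - (p₀ (.inr (.inr (.inr c))) * t))
  refine ⟨b (.inl 0), b (.inl 1), hb (.inl (.inl 0)), hb (.inl (.inl 1)), fun i => ?_,
    fun c => ⟨-b (.inr c), fun ht => ?_, fun d hd => ?_⟩⟩
  · have := hb (.inr (.inl i))
    rw [value_conf_slope, sign_value_slope hx₀ hp₀ h, sign_pos_mul (hp₀ _)] at this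
    exact this
  · have := hb (.inl (.inr c))
    simp only [value, Sum.elim_inl, Sum.elim_inr, ht, mul_zero, neg_zero, sign_zero] at this
    rw [neg_eq_zero, ← sign_eq_zero_iff, ← this]
  · have := hb (.inr (.inr (c, d)))
    rw [value_conf_point, sign_value_point hp₀ h, sign_pos_mul (hp₀ _)] at this
    simp only [Sum.elim_inl, Sum.elim_inr, Matrix.cons_val_zero, Matrix.cons_val_one, hd,
      neg_add_cancel, sign_zero] at this
    have := sign_eq_zero_iff.1 this.symm
    linarith

theorem slope_strictMono (hx₀ : x₀ ∈ M.sol) (hp₀ : ∀ b, 0 < p₀ b)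
    (h : CovLE (M.conf x₀ p₀) x) : StrictMono (slope x) := by
  intro i i' hi
  obtain ⟨b0, b1, -, h1, hs, -⟩ := exists_transfer hx₀ hp₀ h (p₀ (.inr (.inl ())) * x₀ i) (-1) 0
  have e1 := hs i
  have e2 := hs i'
  rw [mul_neg_one, add_neg_cancel, sign_zero, eq_comm, sign_eq_zero_iff] at e1
  have hlt : p₀ (.inr (.inl ())) * x₀ i + p₀ (.inr (.inl ())) * x₀ i' * -1 < 0 := by
    nlinarith [hp₀ (.inr (.inl ())), hx₀.2.1 hi]
  rw [sign_neg hlt, eq_comm, sign_eq_neg_one_iff] at e2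
  rw [sign_neg (by norm_num : (-1 : ℝ) < 0), eq_comm, sign_eq_neg_one_iff] at h1
  nlinarith

theorem slope_of_line (hx₀ : x₀ ∈ M.sol) (hp₀ : ∀ b, 0 < p₀ b) (h : CovLE (M.conf x₀ p₀) x)
    (c : Fin M.g) (b b' : Fin 3) (i : Fin (M.n + 1))
    (hb : M.sndCoord x₀ c b - M.sndCoord x₀ c b' =
      x₀ i * (M.fstCoord x₀ c b - M.fstCoord x₀ c b')) :
    affCoord x 1 c b - affCoord x 1 c b' = slope x i * (affCoord x 0 c b - affCoord x 0 c b') := by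
  obtain ⟨b0, b1, -, h1, hs, hc⟩ := exists_transfer hx₀ hp₀ h (p₀ (.inr (.inl ())) * x₀ i) (-1)
    (M.fstCoord x₀ c b * (p₀ (.inr (.inl ())) * x₀ i) +
      p₀ (.inr (.inl ())) * M.sndCoord x₀ c b * -1)
  obtain ⟨s, -, hs'⟩ := hc c
  have e1 := hs i
  rw [mul_neg_one, add_neg_cancel, sign_zero, eq_comm, sign_eq_zero_iff] at e1
  have f1 := hs' b rfl
  have f2 := hs' b' (by linear_combination p₀ (.inr (.inl ())) * hb)
  rw [sign_neg (by norm_num : (-1 : ℝ) < 0), eq_comm, sign_eq_neg_one_iff] at h1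
  refine mul_right_cancel₀ h1.ne ?_
  linear_combination f1 - f2 - (affCoord x 0 c b - affCoord x 0 c b') * e1

theorem slope_of_origin (hx₀ : x₀ ∈ M.sol) (hp₀ : ∀ b, 0 < p₀ b) (h : CovLE (M.conf x₀ p₀) x)
    (c : Fin M.g) (b : Fin 3) (i : Fin (M.n + 1))
    (hb : M.sndCoord x₀ c b = x₀ i * M.fstCoord x₀ c b) :
    affCoord x 1 c b = slope x i * affCoord x 0 c b := by
  obtain ⟨b0, b1, -, h1, hs, hc⟩ := exists_transfer hx₀ hp₀ h (p₀ (.inr (.inl ())) * x₀ i) (-1) 0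
  obtain ⟨s, hs0, hs'⟩ := hc c
  have e1 := hs i
  rw [mul_neg_one, add_neg_cancel, sign_zero, eq_comm, sign_eq_zero_iff] at e1
  have f1 := hs' b (by rw [hb]; ring)
  rw [hs0 rfl] at f1
  rw [sign_neg (by norm_num : (-1 : ℝ) < 0), eq_comm, sign_eq_neg_one_iff] at h1
  refine mul_right_cancel₀ h1.ne ?_
  linear_combination f1 - affCoord x 0 c b * e1

theorem snd_eq_of_snd_eq (hx₀ : x₀ ∈ M.sol) (hp₀ : ∀ b, 0 < p₀ b) (h : CovLE (M.conf x₀ p₀) x)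
    (c : Fin M.g) (b b' : Fin 3) (hb : M.sndCoord x₀ c b = M.sndCoord x₀ c b') :
    affCoord x 1 c b = affCoord x 1 c b' := by
  obtain ⟨b0, b1, h0, h1, -, hc⟩ := exists_transfer hx₀ hp₀ h 0 1
    (p₀ (.inr (.inl ())) * M.sndCoord x₀ c b)
  obtain ⟨s, -, hs'⟩ := hc c
  have f1 := hs' b (by ring)
  have f2 := hs' b' (by rw [hb]; ring)
  rw [sign_zero, eq_comm, sign_eq_zero_iff] at h0
  rw [sign_one, eq_comm, sign_eq_one_iff] at h1
  refine mul_right_cancel₀ h1.ne' ?_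
  linear_combination f1 - f2 - (affCoord x 0 c b - affCoord x 0 c b') * h0

theorem fst_eq_of_fst_eq (hx₀ : x₀ ∈ M.sol) (hp₀ : ∀ b, 0 < p₀ b) (h : CovLE (M.conf x₀ p₀) x)
    (c : Fin M.g) (b b' : Fin 3) (hb : M.fstCoord x₀ c b = M.fstCoord x₀ c b') :
    affCoord x 0 c b = affCoord x 0 c b' := by
  obtain ⟨b0, b1, h0, h1, -, hc⟩ := exists_transfer hx₀ hp₀ h 1 0 (M.fstCoord x₀ c b)
  obtain ⟨s, -, hs'⟩ := hc c
  have f1 := hs' b (by ring)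
  have f2 := hs' b' (by rw [hb]; ring)
  rw [sign_zero, eq_comm, sign_eq_zero_iff] at h1
  rw [sign_one, eq_comm, sign_eq_one_iff] at h0
  refine mul_right_cancel₀ h0.ne' ?_
  linear_combination f1 - f2 - (affCoord x 1 c b - affCoord x 1 c b') * h1

theorem affCoord_eq_zero (h : CovLE (M.conf x₀ p₀) x)
    (c : Fin M.g) (b : Fin 3) (d : Fin 2)
    (h0 : (if d = 0 then M.fstCoord x₀ c b else M.sndCoord x₀ c b) = 0) :
    affCoord x d c b = 0 := by
  rw [affCoord, div_eq_zero_iff]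
  left
  rw [← sign_eq_zero_iff, ← h.sign_eq, sign_eq_zero_iff]
  simp only [conf]
  split_ifs at h0 ⊢ <;> simp [h0]

theorem slope_eq (hx₀ : x₀ ∈ M.sol) (hp₀ : ∀ b, 0 < p₀ b) (h : CovLE (M.conf x₀ p₀) x)
    (i : Fin (M.n + 1)) : slope x i = slope x 0 * toSol x i := by
  have := (slope_pos hx₀ hp₀ h 0).ne'
  rw [toSol]
  field_simp

theorem gadget_eq (hx₀ : x₀ ∈ M.sol) (hp₀ : ∀ b, 0 < p₀ b) (h : CovLE (M.conf x₀ p₀) x)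
    (c : Fin M.g) :
    (toSol x (M.k c) = if M.isMul c then toSol x (M.i c) * toSol x (M.j c)
      else toSol x (M.i c) + toSol x (M.j c)) ∧
    ∀ b, affCoord x 0 c b = affCoord x 0 c 2 * M.fstCoord (toSol x) c b ∧
      affCoord x 1 c b = affCoord x 0 c 2 * (slope x 0 * M.sndCoord (toSol x) c b) := by
  have hk := hx₀.2.2 c
  have hl := affCoord_two_pos hp₀ h c
  have hr := slope_pos hx₀ hp₀ h 0
  have line := slope_of_line hx₀ hp₀ h c
  have origin := slope_of_origin hx₀ hp₀ h c
  have zero := affCoord_eq_zero h c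
  have v23 := fst_eq_of_fst_eq hx₀ hp₀ h c 1 2 (by
    unfold fstCoord
    split_ifs <;> rfl)
  by_cases hm : M.isMul c
  · simp only [hm, if_true] at hk ⊢
    have hi := (one_pos.trans_le (one_le_of_mem_sol hx₀ (M.i c))).ne'
    have z1 := zero 0 1 (by simp [sndCoord, hm])
    have o2 := origin 1 0 (by simp [fstCoord, sndCoord, hm, hx₀.1])
    have o3 := origin 2 (M.j c) (by simp [fstCoord, sndCoord, hm])
    have l12 := line 1 0 (M.i c) (by simp [fstCoord, sndCoord, hm, hi])
    have l13 := line 2 0 (M.k c) (by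
      rw [hk]
      simp [fstCoord, sndCoord, hm]
      field_simp)
    rw [slope_eq hx₀ hp₀ h (M.j c)] at o3
    rw [slope_eq hx₀ hp₀ h (M.i c)] at l12
    rw [slope_eq hx₀ hp₀ h (M.k c)] at l13
    rw [z1, sub_zero] at l12 l13
    rw [v23] at o2 l12
    have e1 : affCoord x 0 c 2 = toSol x (M.i c) * (affCoord x 0 c 2 - affCoord x 0 c 0) := by
      refine mul_left_cancel₀ hr.ne' ?_
      linear_combination l12 - o2
    have e0 : affCoord x 0 c 2 - affCoord x 0 c 0 ≠ 0 := fun h0 => by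
      rw [h0, mul_zero] at e1
      exact hl.ne' e1
    have e2 : toSol x (M.i c) ≠ 0 := fun h0 => by
      rw [h0, zero_mul] at e1
      exact hl.ne' e1
    refine ⟨mul_left_cancel₀ hr.ne' (mul_right_cancel₀ e0 ?_), ?_⟩
    · linear_combination o3 - l13 + slope x 0 * toSol x (M.j c) * e1
    · have e3 : affCoord x 0 c 0 = affCoord x 0 c 2 * (1 - 1 / toSol x (M.i c)) := by
        field_simp
        linear_combination e1
      simp only [fstCoord, sndCoord, hm, if_true, Fin.forall_fin_succ, IsEmpty.forall_iff, and_true]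
      refine ⟨⟨by simpa using e3, by simpa using z1⟩, ⟨by simpa using v23, ?_⟩, by simp, ?_⟩
      · simp
        linear_combination o2
      · simp
        linear_combination o3
  · simp only [hm] at hk ⊢
    simp only [Bool.false_eq_true, if_false] at hk ⊢
    have z1 := zero 0 0 (by simp [fstCoord, hm])
    have o2 := origin 1 (M.j c) (by simp [fstCoord, sndCoord, hm])
    have o3 := origin 2 (M.k c) (by simp [fstCoord, sndCoord, hm, hk])
    have l12 := snd_eq_of_snd_eq hx₀ hp₀ h c 0 1 (by simp [sndCoord, hm])
    have l13 := line 2 0 (M.i c) (by simp [fstCoord, sndCoord, hm])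
    rw [slope_eq hx₀ hp₀ h (M.j c)] at o2
    rw [slope_eq hx₀ hp₀ h (M.k c)] at o3
    rw [slope_eq hx₀ hp₀ h (M.i c)] at l13
    rw [z1, sub_zero, l12, o2, o3, v23] at l13
    rw [v23] at o2
    have e : toSol x (M.k c) = toSol x (M.i c) + toSol x (M.j c) := by
      refine mul_left_cancel₀ (mul_pos hr hl).ne' ?_
      linear_combination l13
    refine ⟨e, ?_⟩
    rw [e] at o3
    simp only [fstCoord, sndCoord, hm, Fin.forall_fin_succ, IsEmpty.forall_iff, and_true]
    refine ⟨⟨by simpa using z1, ?_⟩, ⟨by simpa using v23, ?_⟩, by simp, ?_⟩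
    · simp
      linear_combination l12 + o2
    · simp
      linear_combination o2
    · simp
      linear_combination o3

theorem toSol_mem (hx₀ : x₀ ∈ M.sol) (hp₀ : ∀ b, 0 < p₀ b) (h : CovLE (M.conf x₀ p₀) x) :
    toSol x ∈ M.sol := by
  have hr := slope_pos hx₀ hp₀ h 0
  exact ⟨div_self hr.ne', fun i i' hi => div_lt_div_of_pos_right
    (slope_strictMono hx₀ hp₀ h hi) hr, fun c => (gadget_eq hx₀ hp₀ h c).1⟩

theorem toPar_pos (hx₀ : x₀ ∈ M.sol) (hp₀ : ∀ b, 0 < p₀ b) (h : CovLE (M.conf x₀ p₀) x)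
    (b : M.Par) : 0 < toPar x b := by
  rcases b with i | ⟨⟩ | ⟨c, b⟩ | c
  · exact slope_entries_pos hx₀ hp₀ h i 0
  · exact slope_pos hx₀ hp₀ h 0
  · exact point_gadget_pos hp₀ h c b
  · exact affCoord_two_pos hp₀ h c

theorem conf_toSol_toPar (hx₀ : x₀ ∈ M.sol) (hp₀ : ∀ b, 0 < p₀ b)
    (h : CovLE (M.conf x₀ p₀) x) : M.conf (toSol x) (toPar x) = x := by
  funext e
  obtain ⟨i | ⟨c, b⟩, d | c'⟩ := e
  · have h0 := (slope_entries_pos hx₀ hp₀ h i 0).ne'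
    have e : slope x i * x (.inl i, .inl 0) = x (.inl i, .inl 1) := div_mul_cancel₀ _ h0
    fin_cases d
    · rfl
    · simp only [conf, toPar]
      rw [slope_eq hx₀ hp₀ h] at e
      simp
      linear_combination e
  · exact (slope_gadget_eq_zero h i c').symm
  · have h0 := (point_gadget_pos hp₀ h c b).ne'
    have e : ∀ d, affCoord x d c b * x (.inr (c, b), .inr c) = x (.inr (c, b), .inl d) :=
      fun d => div_mul_cancel₀ _ h0
    obtain ⟨g0, g1⟩ := (gadget_eq hx₀ hp₀ h c).2 b
    have e0 := e 0
    have e1 := e 1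
    fin_cases d
    · simp only [conf, toPar]
      simp
      linear_combination e0 - x (.inr (c, b), .inr c) * g0
    · simp only [conf, toPar]
      simp
      linear_combination e1 - x (.inr (c, b), .inr c) * g1
  · simp only [conf, toPar]
    split_ifs with hc
    · rw [hc]
    · exact (point_gadget_eq_zero h c b hc).symm

end Backward

theorem ratOn_conf {S : Set (Fin (M.n + 1) ⊕ M.Par → ℝ)}
    (hS : ∀ z ∈ S, (fun i => z (.inl i)) ∈ M.sol) (e : M.Row × M.Col) :
    RatOn S (fun z => M.conf (fun i => z (.inl i)) (fun b => z (.inr b)) e) := by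
  have hne : ∀ i, ∀ z ∈ S, z (.inl i) ≠ 0 := fun i z hz =>
    (one_pos.trans_le (one_le_of_mem_sol (hS z hz) i)).ne'
  have c := fun i => RatOn.coord (S := S) i
  obtain ⟨i | ⟨g, b⟩, d | g'⟩ := e
  · simp only [conf]
    split_ifs
    · exact c _
    · exact ((c _).mul (c _)).mul (c _)
  · exact .const 0
  · simp only [conf]
    refine ((c _).mul (c _)).mul ?_
    split_ifs
    · simp only [fstCoord]
      split_ifs
      · fin_cases b
        · exact (RatOn.const 1).sub ((RatOn.const 1).div (c _) (hne _))
        · exact .const 1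
        · exact .const 1
      · fin_cases b
        · exact .const 0
        · exact .const 1
        · exact .const 1
    · refine (c _).mul ?_
      simp only [sndCoord]
      split_ifs
      · fin_cases b
        · exact .const 0
        · exact .const 1
        · exact c _
      · fin_cases b
        · exact c _
        · exact c _
        · exact (c _).add (c _)
  · simp only [conf]
    split_ifs
    · exact c _
    · exact .const 0

theorem seq_oriented {x₀ : Fin (M.n + 1) → ℝ} {p₀ : M.Par → ℝ} (hx₀ : x₀ ∈ M.sol)
    (hp₀ : ∀ b, 0 < p₀ b) : SEq M.sol (oriented (M.conf x₀ p₀)) := by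
  refine (SEq.of_fibre (T := {z | (fun i => z (.inl i)) ∈ M.sol ∧ (∀ _ : Empty, (0 : ℝ) = 0) ∧
    ∀ b : M.Par, 0 < z (.inr b)}) (fun _ _ _ => 0) (fun b _ y => y b) (fun b => b.elim)
    (fun b => .coord b) (fun x y => Iff.rfl)
    (fun x _ => ⟨fun _ => 1, fun _ => rfl, fun _ => one_pos⟩)).trans ?_
  have slope_rat : ∀ i, RatOn (oriented (M.conf x₀ p₀)) (fun x => slope x i) := fun i =>
    (RatOn.coord _).div (.coord _) fun x hx => (slope_entries_pos hx₀ hp₀ hx.1 i 0).ne'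
  refine SEq.of_ratOn (fun z => M.conf (fun i => z (.inl i)) (fun b => z (.inr b)))
    (fun x => Sum.elim (toSol x) (toPar x)) (ratOn_conf fun z hz => hz.1) ?_ ?_ ?_ ?_ ?_
  · rintro (i | i | ⟨⟩ | ⟨c, b⟩ | c)
    · exact (slope_rat i).div (slope_rat 0) fun x hx => (slope_pos hx₀ hp₀ hx.1 0).ne'
    · exact .coord _
    · exact slope_rat 0
    · exact .coord _
    · exact (RatOn.coord _).div (.coord _) fun x hx => (point_gadget_pos hp₀ hx.1 c 2).ne'
  · rintro z ⟨hz, -, hp⟩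
    exact ⟨covLE_conf hx₀ hz hp₀ hp, covLE_conf hz hx₀ hp hp₀⟩
  · rintro x ⟨hx, -⟩
    exact ⟨toSol_mem hx₀ hp₀ hx, fun _ => rfl, toPar_pos hx₀ hp₀ hx⟩
  · rintro z ⟨hz, -, hp⟩
    funext i
    rcases i with i | b
    · exact congrFun (toSol_conf hz hp) i
    · exact congrFun (toPar_conf hz hp) b
  · rintro x ⟨hx, -⟩
    exact conf_toSol_toPar hx₀ hp₀ hx

end Shor

/-- A Shor system, with its relations indexed by `Fin g`. -/
def Sys.toShor (s : Sys) : Shor where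
  n := s.N
  g := s.L.length
  isMul c := (s.L.get c).isMul
  i c := ⟨(s.L.get c).i, Nat.lt_succ_of_le (s.valid _ (s.L.get_mem c)).1⟩
  j c := ⟨(s.L.get c).j, Nat.lt_succ_of_le (s.valid _ (s.L.get_mem c)).2.1⟩
  k c := ⟨(s.L.get c).k, Nat.lt_succ_of_le (s.valid _ (s.L.get_mem c)).2.2.1⟩
  ne_zero c hc := by
    have := (s.valid _ (s.L.get_mem c)).2.2.2 hc
    simp only [ne_eq, Fin.ext_iff, Fin.val_zero]
    omega

theorem Sys.sol_toShor (s : Sys) : s.toShor.sol = zeroSet s.N s.Sat := by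
  refine Set.ext fun (x : Fin (s.N + 1) → ℝ) => ?_
  have hx : ∀ k (hk : k ≤ s.N), Universality.ext x k = x ⟨k, Nat.lt_succ_of_le hk⟩ :=
    fun k hk => ext_of_le x hk
  change (x 0 = 1 ∧ StrictMono x ∧ ∀ c : Fin s.L.length, _) ↔ (Universality.ext x 0 = 1 ∧ _ ∧ _)
  rw [hx 0 (Nat.zero_le _), List.forall_mem_iff_get]
  refine and_congr_right fun _ => and_congr ?_ (forall_congr' fun c => ?_)
  · rw [Fin.strictMono_iff_lt_succ, Fin.forall_iff]
    refine forall₂_congr fun i hi => ?_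
    rw [hx i (le_of_lt hi), hx (i + 1) hi]
    rfl
  · obtain ⟨h1, h2, h3, -⟩ := s.valid _ (s.L.get_mem c)
    rw [Rel.Holds, hx _ h1, hx _ h2, hx _ h3]
    rfl

/-- `S` is the zero set on the points `y i` of an affine functional that is nonnegative on them. -/
def SupportSet {n d : ℕ} (y : Fin n → Fin d → ℝ) (S : Finset (Fin n)) : Prop :=
  ∃ (w : Fin d → ℝ) (c : ℝ), ∀ i, 0 ≤ c + ∑ k, w k * y i k ∧
    (c + ∑ k, w k * y i k = 0 ↔ i ∈ S)

section Faces

variable {n d : ℕ} {y : Fin n → Fin d → ℝ} {S : Finset (Fin n)}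

theorem SupportSet.exists_isExposed (h : SupportSet y S) :
    ∃ F, IsExposed ℝ (convexHull ℝ (Set.range y)) F ∧ F ⊆ convexHull ℝ (Set.range y) ∧
      ∀ i, y i ∈ F ↔ i ∈ S := by
  obtain ⟨w, c, h⟩ := h
  let l : (Fin d → ℝ) →ₗ[ℝ] ℝ := ∑ k, w k • LinearMap.proj k
  have hl : ∀ x, l x = ∑ k, w k * x k := fun x => by simp [l]
  simp only [← hl] at h
  have hconv : convexHull ℝ (Set.range y) ⊆ {x | -c ≤ l x} :=
    convexHull_min (by
      rintro _ ⟨i, rfl⟩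
      have := (h i).1
      simp only [Set.mem_ofPred_eq]
      linarith) (convex_halfSpace_ge l.isLinear _)
  refine ⟨{x ∈ convexHull ℝ (Set.range y) | l x = -c}, ?_, fun x hx => hx.1, fun i => ?_⟩
  · rintro ⟨x₀, hx₀, e₀⟩
    refine ⟨-LinearMap.toContinuousLinearMap l, ?_⟩
    ext x
    simp only [Set.mem_ofPred_eq, neg_apply,
      LinearMap.coe_toContinuousLinearMap', neg_le_neg_iff]
    refine and_congr_right fun hx => ⟨fun e z hz => e ▸ hconv hz, fun e => ?_⟩
    exact le_antisymm (e₀ ▸ e x₀ hx₀) (hconv hx)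
  · rw [← (h i).2]
    simp only [Set.mem_ofPred_eq]
    refine ⟨fun e => by linarith [e.2], fun e =>
      ⟨subset_convexHull ℝ _ (Set.mem_range_self i), by linarith⟩⟩

theorem SupportSet.isVertexSetOfFace
    (hy : ∀ i, y i ∈ Set.extremePoints ℝ (convexHull ℝ (Set.range y)))
    (h : SupportSet y S) : IsVertexSetOfFace y S := by
  obtain ⟨F, hF, hsub, hS⟩ := h.exists_isExposed
  refine ⟨F, .inr hF, Set.Subset.antisymm (fun x hx => ?_) ?_⟩
  · obtain ⟨i, rfl⟩ := extremePoints_convexHull_subset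
      (hF.isExtreme.extremePoints_subset_extremePoints hx)
    exact ⟨i, (hS i).1 hx.1, rfl⟩
  · rintro _ ⟨i, hi, rfl⟩
    exact inter_extremePoints_subset_extremePoints_of_subset hsub ⟨(hS i).2 hi, hy i⟩

theorem IsVertexSetOfFace.supportSet (hinj : Function.Injective y)
    (hy : ∀ i, y i ∈ Set.extremePoints ℝ (convexHull ℝ (Set.range y)))
    (h : IsVertexSetOfFace y S) : SupportSet y S := by
  obtain ⟨F, hF, hS⟩ := h
  have mem : ∀ i, F ⊆ convexHull ℝ (Set.range y) → (y i ∈ F ↔ i ∈ S) := fun i hsub => by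
    rw [← Finset.mem_coe, ← hinj.mem_set_image (s := (S : Set (Fin n))), ← hS]
    exact ⟨fun h => inter_extremePoints_subset_extremePoints_of_subset hsub ⟨h, hy i⟩,
      fun h => h.1⟩
  rcases hF with rfl | hF
  · refine ⟨0, 0, fun i => ?_⟩
    simpa using (mem i le_rfl).1 (hy i).1
  · rcases F.eq_empty_or_nonempty with rfl | hne
    · refine ⟨0, 1, fun i => ?_⟩
      simpa using (mem i (Set.empty_subset _)).not.1 (Set.notMem_empty _)
    · obtain ⟨l, rfl⟩ := hF hne
      obtain ⟨x, hx, hmax⟩ := hne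
      have hl : ∀ z, l z = ∑ k, l (Pi.single k 1) * z k := fun z => by
        conv_lhs => rw [pi_eq_sum_univ' z]
        simp [map_sum, mul_comm]
      refine ⟨fun k => - l (Pi.single k 1), l x, fun i => ?_⟩
      have hi := (hy i).1
      have e : l x + ∑ k, - l (Pi.single k 1) * y i k = l x - l (y i) := by
        rw [hl (y i)]
        simp [sub_eq_add_neg]
      rw [e, ← mem i fun z hz => hz.1]
      refine ⟨sub_nonneg.2 (hmax _ hi), fun e => ⟨hi, fun z hz => ?_⟩, fun e => ?_⟩
      · linarith [hmax z hz]
      · linarith [hmax _ hi, e.2 x hx]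

theorem injective_of_supportSet (h : ∀ i, SupportSet y {i}) : Function.Injective y := by
  intro i j hij
  obtain ⟨w, c, hw⟩ := h j
  have := (hw i).2
  rw [hij, (hw j).2] at this
  simpa using this

theorem mem_extremePoints_of_supportSet (h : ∀ i, SupportSet y {i}) (i : Fin n) :
    y i ∈ Set.extremePoints ℝ (convexHull ℝ (Set.range y)) := by
  obtain ⟨F, hF, -, hS⟩ := (h i).exists_isExposed
  have hcpt := hF.isCompact ((Set.finite_range y).isCompact_convexHull ℝ)
  obtain ⟨x, hx⟩ := hcpt.extremePoints_nonempty ⟨y i, (hS i).2 (Finset.mem_singleton_self i)⟩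
  have hx' := hF.isExtreme.extremePoints_subset_extremePoints hx
  obtain ⟨j, rfl⟩ := extremePoints_convexHull_subset hx'
  rwa [Finset.mem_singleton.1 ((hS j).1 hx.1)] at hx'

theorem mem_realizationSpace_iff {v : Fin n → Fin d → ℝ} {B : Finset (Fin n)}
    (hv : ∀ i, SupportSet v {i}) (hn : ∀ j, ¬ SupportSet v (Finset.univ.erase j)) :
    y ∈ polytopeRealizationSpace v B ↔
      (∀ i ∈ B, y i = v i) ∧ ∀ S, SupportSet y S ↔ SupportSet v S := by
  have key : ∀ {u : Fin n → Fin d → ℝ}, Function.Injective u →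
      (∀ i, u i ∈ Set.extremePoints ℝ (convexHull ℝ (Set.range u))) →
      ∀ S, IsVertexSetOfFace u S ↔ SupportSet u S := fun hinj hu S =>
    ⟨fun h => IsVertexSetOfFace.supportSet hinj hu h, fun h => h.isVertexSetOfFace hu⟩
  have kv := key (injective_of_supportSet hv) (mem_extremePoints_of_supportSet hv)
  refine and_congr_right fun _ => ⟨fun ⟨hy, h⟩ S => ?_, fun h => ?_⟩
  · refine (key (fun i j hij => ?_) hy S).symm.trans ((h S).trans (kv S))
    by_contra hne
    refine hn j ((kv _).1 ((h _).1 ⟨_, .inl rfl, ?_⟩))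
    refine Set.Subset.antisymm (fun x hx => ?_) ?_
    · obtain ⟨k, rfl⟩ := extremePoints_convexHull_subset hx
      rcases eq_or_ne k j with rfl | hk
      · exact ⟨i, by simpa using hne, hij⟩
      · exact ⟨k, by simpa using hk, rfl⟩
    · rintro _ ⟨k, -, rfl⟩
      exact hy k
  · have hy : ∀ i, SupportSet y {i} := fun i => (h _).2 (hv i)
    refine ⟨mem_extremePoints_of_supportSet hy, fun S => ?_⟩
    rw [key (injective_of_supportSet hy) (mem_extremePoints_of_supportSet hy), h, kv]

end Faces

/-- `S` is the zero set on the vectors `Y i` of a linear functional that is nonnegative on them. -/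
def ConeSupportSet {N K : Type*} [Fintype K] (Y : N → K → ℝ) (S : Set N) : Prop :=
  ∃ ψ : K → ℝ, ∀ i, 0 ≤ ∑ k, ψ k * Y i k ∧ (∑ k, ψ k * Y i k = 0 ↔ i ∈ S)

/-- The ways in which a hyperplane supporting a Lawrence polytope can contain the two vertices
arising from a vector, in terms of the sign of the corresponding covector at this vector. -/
def Compat (s : SignType) (p q : Prop) : Prop :=
  (s = 1 → ¬ q) ∧ (s = 0 → (p ↔ q)) ∧ (s = -1 → ¬ p)

theorem exists_iff_compat {r s : ℝ} {p q : Prop} (hr : 0 < r) :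
    (∃ b, (0 ≤ b ∧ (b = 0 ↔ p)) ∧ 0 ≤ r * b + s ∧ (r * b + s = 0 ↔ q)) ↔
      Compat (sign s) p q := by
  constructor
  · rintro ⟨b, ⟨hb, hp⟩, h, hq⟩
    have := mul_nonneg hr.le hb
    refine ⟨fun e => ?_, fun e => ?_, fun e => ?_⟩
    · rw [sign_eq_one_iff] at e
      rw [← hq]
      linarith
    · rw [sign_eq_zero_iff] at e
      rw [← hq, ← hp, e, add_zero, mul_eq_zero, or_iff_right hr.ne']
    · rw [sign_eq_neg_one_iff] at e
      rw [← hp]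
      rintro rfl
      linarith
  · rintro ⟨h1, h0, h2⟩
    rcases lt_trichotomy s 0 with hs | rfl | hs
    · have hp := h2 (sign_neg hs)
      by_cases hq : q
      · have : 0 < -s / r := div_pos (neg_pos.2 hs) hr
        have e : r * (-s / r) + s = 0 := by
          field_simp
          ring
        exact ⟨-s / r, ⟨this.le, iff_of_false this.ne' hp⟩, e.ge, iff_of_true e hq⟩
      · have : 0 < (1 - s) / r := div_pos (by linarith) hr
        have e : r * ((1 - s) / r) + s = 1 := by
          field_simp
          ring
        exact ⟨(1 - s) / r, ⟨this.le, iff_of_false this.ne' hp⟩, by rw [e]; exact zero_le_one,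
          iff_of_false (by rw [e]; exact one_ne_zero) hq⟩
    · have hpq := h0 sign_zero
      by_cases hq : q
      · exact ⟨0, ⟨le_rfl, by simp [hpq, hq]⟩, by simp [hq]⟩
      · exact ⟨1, ⟨zero_le_one, by simp [hpq, hq]⟩, by simp [hr.le, hr.ne', hq]⟩
    · have hq := h1 (sign_pos hs)
      by_cases hp : p
      · exact ⟨0, ⟨le_rfl, by simp [hp]⟩, by simp [hs.le, hs.ne', hq]⟩
      · have : 0 < r * 1 + s := by linarith
        exact ⟨1, ⟨zero_le_one, by simp [hp]⟩, this.le, iff_of_false this.ne' hq⟩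

section Lawrence

variable {I J : Type*} [Fintype I]

/-- The scaling factors of the vectors of a normalized Lawrence configuration. -/
def scale (x : J × I → ℝ) (c : I → ℝ) : I ⊕ J → ℝ :=
  Sum.elim c fun j => 1 - ∑ k, x (j, k) * (1 - c k)

theorem scale_one (x : J × I → ℝ) (e : I ⊕ J) : scale x 1 e = 1 := by
  rcases e with k | j <;> simp [scale]

variable [Fintype J] [DecidableEq J]

/-- The last vertices of the Lawrence polytope of the vector configuration `x`. -/
def lawrence (x : J × I → ℝ) (c : I → ℝ) : J × ((I ⊕ J) ⊕ I) → ℝ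
  | (j, .inl (.inl k)) => -(c k * x (j, k))
  | (j, .inl (.inr j')) => if j' = j then scale x c (.inr j) else 0
  | (j, .inr k) => x (j, k)

variable {x x' : J × I → ℝ} {c c' : I → ℝ}

theorem sum_lawrence (x : J × I → ℝ) (c : I → ℝ) (j : J) : ∑ k, lawrence x c (j, k) = 1 := by
  have e : ∀ k, x (j, k) * (1 - c k) = x (j, k) - c k * x (j, k) := fun k => by ring
  simp only [Fintype.sum_sum_type, lawrence, scale, Sum.elim_inr, e, Finset.sum_sub_distrib,
    Finset.sum_neg_distrib, Finset.sum_ite_eq', Finset.mem_univ, if_true]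
  ring

variable [DecidableEq I]

/-- Barycentric coordinates of the vertices of a Lawrence polytope, the last ones being `z`. -/
def lift (z : J × ((I ⊕ J) ⊕ I) → ℝ) : (I ⊕ J) ⊕ (I ⊕ J) → (I ⊕ J) ⊕ I → ℝ
  | .inl e => Pi.single (.inl e) 1
  | .inr (.inl k) => Pi.single (.inr k) 1
  | .inr (.inr j) => fun k => z (j, k)

theorem sum_mul_lift_inl (ψ : (I ⊕ J) ⊕ I → ℝ) (z : J × ((I ⊕ J) ⊕ I) → ℝ) (e : I ⊕ J) :
    ∑ k, ψ k * lift z (.inl e) k = ψ (.inl e) := by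
  simp [lift, Pi.single_apply]

theorem sum_mul_lift_lawrence (ψ : (I ⊕ J) ⊕ I → ℝ) (x : J × I → ℝ) (c : I → ℝ) (e : I ⊕ J) :
    ∑ k, ψ k * lift (lawrence x c) (.inr e) k = scale x c e * ψ (.inl e) +
      value x (fun k => ψ (.inr k) - c k * ψ (.inl (.inl k))) e := by
  rcases e with k | j
  · simp [lift, Pi.single_apply, scale, value]
  · simp only [lift, Fintype.sum_sum_type, lawrence, value, Sum.elim_inr, mul_sub,
      Finset.sum_sub_distrib, mul_ite, mul_zero, Finset.sum_ite_eq', Finset.mem_univ, if_true]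
    have e1 : ∀ k, ψ (.inl (.inl k)) * -(c k * x (j, k)) =
      -(x (j, k) * (c k * ψ (.inl (.inl k)))) := fun k => by ring
    have e2 : ∀ k, ψ (.inr k) * x (j, k) = x (j, k) * ψ (.inr k) := fun k => mul_comm _ _
    simp only [e1, e2, Finset.sum_neg_distrib]
    ring

theorem coneSupportSet_lawrence (hc : ∀ e, 0 < scale x c e) (S : Set ((I ⊕ J) ⊕ (I ⊕ J))) :
    ConeSupportSet (lift (lawrence x c)) S ↔
      ∃ a, ∀ e, Compat (sign (value x a e)) (.inl e ∈ S) (.inr e ∈ S) := by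
  refine (exists_congr fun ψ => Sum.forall).trans ?_
  simp only [sum_mul_lift_inl, sum_mul_lift_lawrence]
  refine Iff.trans ?_ (exists_congr fun a => forall_congr' fun e => exists_iff_compat (hc e))
  constructor
  · rintro ⟨ψ, h1, h2⟩
    exact ⟨fun k => ψ (.inr k) - c k * ψ (.inl (.inl k)), fun e => ⟨_, h1 e, h2 e⟩⟩
  · rintro ⟨a, h⟩
    choose b hb using h
    refine ⟨Sum.elim b fun k => a k + c k * b (.inl k), fun e => (hb e).1, fun e => ?_⟩
    simpa using (hb e).2

theorem covLE_iff_coneSupportSet (hc : ∀ e, 0 < scale x c e) (hc' : ∀ e, 0 < scale x' c' e) :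
    CovLE x x' ↔ ∀ S, ConeSupportSet (lift (lawrence x c)) S →
      ConeSupportSet (lift (lawrence x' c')) S := by
  simp only [coneSupportSet_lawrence hc, coneSupportSet_lawrence hc']
  constructor
  · rintro h S ⟨a, ha⟩
    obtain ⟨b, hb⟩ := h a
    exact ⟨b, fun e => hb e ▸ ha e⟩
  · intro h a
    obtain ⟨b, hb⟩ := h {i | i.elim (fun e => sign (value x a e) ≠ -1)
      fun e => sign (value x a e) ≠ 1} ⟨a, fun e => by
        simp only [Compat, Set.mem_ofPred_eq, Sum.elim_inl, Sum.elim_inr]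
        generalize sign (value x a e) = s
        revert s
        decide⟩
    refine ⟨b, fun e => ?_⟩
    have := hb e
    simp only [Compat, Set.mem_ofPred_eq, Sum.elim_inl, Sum.elim_inr] at this
    generalize sign (value x a e) = s at this ⊢
    generalize sign (value x' b e) = s' at this ⊢
    revert s s'
    decide

theorem coneSupportSet_lawrence_pair (hc : ∀ e, 0 < scale x c e) (e : I ⊕ J) :
    ConeSupportSet (lift (lawrence x c)) {.inl e, .inr e}ᶜ := by
  rw [coneSupportSet_lawrence hc]
  refine ⟨0, fun e' => ?_⟩
  have : value x 0 e' = 0 := by rcases e' with k | j <;> simp [value]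
  simp [Compat, this]

theorem coneSupportSet_lawrence_singleton (hc : ∀ e, 0 < scale x c e)
    (hx : ∀ j, ∃ k, x (j, k) ≠ 0) (i : (I ⊕ J) ⊕ (I ⊕ J)) :
    ConeSupportSet (lift (lawrence x c)) {i} := by
  rw [coneSupportSet_lawrence hc]
  have key : ∀ e : I ⊕ J, ∃ a, value x a e ≠ 0 := by
    rintro (k | j)
    · exact ⟨1, one_ne_zero⟩
    · obtain ⟨k, hk⟩ := hx j
      exact ⟨Pi.single k 1, by simpa [value, Pi.single_apply] using hk⟩
  have neg : ∀ a e, value x (-a) e = -value x a e := by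
    rintro a (k | j) <;> simp [value]
  have key' : ∀ e : I ⊕ J, ∃ a, 0 < value x a e := fun e => by
    obtain ⟨a, ha⟩ := key e
    rcases ha.lt_or_gt with h | h
    · exact ⟨-a, by rwa [neg, neg_pos]⟩
    · exact ⟨a, h⟩
  rcases i with e | e
  · obtain ⟨a, ha⟩ := key' e
    refine ⟨a, fun e' => ?_⟩
    rcases eq_or_ne e' e with rfl | hne
    · simp [Compat, sign_pos ha]
    · simp [Compat, hne]
  · obtain ⟨a, ha⟩ := key' e
    refine ⟨-a, fun e' => ?_⟩
    rcases eq_or_ne e' e with rfl | hne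
    · have : value x (-a) e' < 0 := by rwa [neg, neg_lt_zero]
      simp [Compat, sign_neg this]
    · simp [Compat, hne]

theorem not_coneSupportSet_lawrence_compl (hc : ∀ e, 0 < scale x c e)
    (hx : ∀ k, ∃ j, x (j, k) ≠ 0) (i : (I ⊕ J) ⊕ (I ⊕ J)) :
    ¬ ConeSupportSet (lift (lawrence x c)) {i}ᶜ := by
  rw [coneSupportSet_lawrence hc]
  rintro ⟨a, ha⟩
  obtain ⟨e, he, h0⟩ : ∃ e, value x a e ≠ 0 ∧ ∀ e', e' ≠ e → value x a e' = 0 := by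
    have zero : ∀ e, .inl e ≠ i → .inr e ≠ i → value x a e = 0 := fun e h1 h2 => by
      have := ha e
      rw [← sign_eq_zero_iff]
      simp only [Compat, Set.mem_compl_iff, Set.mem_singleton_iff, h1, h2] at this
      generalize sign (value x a e) = s at this ⊢
      revert s
      decide
    rcases i with e | e
    · refine ⟨e, fun h => ?_, fun e' he => zero e' (by simpa using he) (by simp)⟩
      simpa [Compat, h] using (ha e).2.1
    · refine ⟨e, fun h => ?_, fun e' he => zero e' (by simp) (by simpa using he)⟩
      simpa [Compat, h] using (ha e).2.1
  rcases e with k | j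
  · obtain ⟨j, hj⟩ := hx k
    have h := h0 (.inr j) (by simp)
    simp only [value, Sum.elim_inr] at h
    rw [Finset.sum_eq_single k (fun l _ hl => by
      rw [show a l = 0 from h0 (.inl l) (by simpa using hl), mul_zero]) (by simp)] at h
    exact (mul_ne_zero hj he) h
  · refine he (Finset.sum_eq_zero fun k _ => ?_)
    rw [show a k = 0 from h0 (.inl k) (by simp), mul_zero]

end Lawrence

section Lawrence

variable {I J : Type*} [Fintype I] [Fintype J] [DecidableEq I] [DecidableEq J]

/-- The normalized realizations of the face lattice of the polytope with barycentric
coordinates `lift z₀`. -/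
def faceSpace (z₀ : J × ((I ⊕ J) ⊕ I) → ℝ) : Set (J × ((I ⊕ J) ⊕ I) → ℝ) :=
  {z | (∀ j, ∑ k, z (j, k) = 1) ∧
    ∀ S, ConeSupportSet (lift z) S ↔ ConeSupportSet (lift z₀) S}

theorem exists_eq_lawrence {z : J × ((I ⊕ J) ⊕ I) → ℝ} (h1 : ∀ j, ∑ k, z (j, k) = 1)
    (h : ∀ e : I ⊕ J, ConeSupportSet (lift z) {.inl e, .inr e}ᶜ) :
    ∃ c, z = lawrence (fun p => z (p.1, .inr p.2)) c ∧
      ∀ e, 0 < scale (fun p : J × I => z (p.1, .inr p.2)) c e := by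
  have vanish : ∀ {e : I ⊕ J} {ψ : (I ⊕ J) ⊕ I → ℝ},
      (∀ i, 0 ≤ ∑ k, ψ k * lift z i k ∧
        (∑ k, ψ k * lift z i k = 0 ↔ i ∈ ({.inl e, .inr e}ᶜ : Set _))) →
      0 < ψ (.inl e) ∧ (∀ e', e' ≠ e → ψ (.inl e') = 0) ∧
      (∀ k, .inl k ≠ e → ψ (.inr k) = 0) ∧ (∀ k, .inl k = e → 0 < ψ (.inr k)) ∧
      (∀ j, .inr j ≠ e → ∑ k, ψ k * z (j, k) = 0) ∧
      ∀ j, .inr j = e → 0 < ∑ k, ψ k * z (j, k) := by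
    intro e ψ hψ
    have sing : ∀ k, ∑ l, ψ l * lift z (.inr (.inl k)) l = ψ (.inr k) := fun k => by
      simp [lift, Pi.single_apply]
    refine ⟨?_, fun e' he => ?_, fun k hk => ?_, fun k hk => ?_, fun j hj => ?_, fun j hj => ?_⟩
    · have := hψ (.inl e)
      rw [sum_mul_lift_inl] at this
      exact this.1.lt_of_ne' (this.2.not.2 (by simp))
    · have := (hψ (.inl e')).2.2 (by simpa using he)
      rwa [sum_mul_lift_inl] at this
    · have := (hψ (.inr (.inl k))).2.2 (by simpa using hk)
      rwa [sing] at this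
    · have := hψ (.inr (.inl k))
      rw [sing] at this
      exact this.1.lt_of_ne' (this.2.not.2 (by simp [hk]))
    · exact (hψ (.inr (.inr j))).2.2 (by simpa using hj)
    · have := hψ (.inr (.inr j))
      exact this.1.lt_of_ne' (this.2.not.2 (by simp [hj]))
  have hcol : ∀ k, ∃ c : ℝ, 0 < c ∧ ∀ j, z (j, .inl (.inl k)) = -(c * z (j, .inr k)) := by
    intro k
    obtain ⟨ψ, hψ⟩ := h (.inl k)
    obtain ⟨h0, h2, h3, h4, h5, -⟩ := vanish hψ
    refine ⟨ψ (.inr k) / ψ (.inl (.inl k)), div_pos (h4 k rfl) h0, fun j => ?_⟩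
    have := h5 j (by simp)
    rw [Fintype.sum_sum_type, Fintype.sum_eq_single (.inl k) fun e he => by rw [h2 e he, zero_mul],
      Fintype.sum_eq_single k fun l hl => by rw [h3 l (by simpa using hl), zero_mul]] at this
    field_simp
    linear_combination this
  have hrow : ∀ j j', j' ≠ j → z (j', .inl (.inr j)) = 0 := fun j j' hj => by
    obtain ⟨ψ, hψ⟩ := h (.inr j)
    obtain ⟨h0, h2, h3, -, h5, -⟩ := vanish hψ
    have := h5 j' (by simpa using hj)
    rw [Fintype.sum_sum_type, Fintype.sum_eq_single (.inr j) fun e he => by rw [h2 e he, zero_mul],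
      Finset.sum_eq_zero (fun k _ => by rw [h3 k (by simp), zero_mul]), add_zero] at this
    exact (mul_eq_zero.1 this).resolve_left h0.ne'
  have hdiag : ∀ j, 0 < z (j, .inl (.inr j)) := fun j => by
    obtain ⟨ψ, hψ⟩ := h (.inr j)
    obtain ⟨h0, h2, h3, -, -, h6⟩ := vanish hψ
    have := h6 j rfl
    rw [Fintype.sum_sum_type, Fintype.sum_eq_single (.inr j) fun e he => by rw [h2 e he, zero_mul],
      Finset.sum_eq_zero (fun k _ => by rw [h3 k (by simp), zero_mul]), add_zero] at this
    exact pos_of_mul_pos_right this h0.le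
  choose c hc0 hc using hcol
  have hscale : ∀ j, scale (fun p : J × I => z (p.1, .inr p.2)) c (.inr j) =
      z (j, .inl (.inr j)) := fun j => by
    have := h1 j
    rw [Fintype.sum_sum_type, Fintype.sum_sum_type,
      Fintype.sum_eq_single j fun j' hj => hrow j' j hj.symm] at this
    simp only [hc, Finset.sum_neg_distrib] at this
    have e : ∀ k, z (j, .inr k) * (1 - c k) = z (j, .inr k) - c k * z (j, .inr k) :=
      fun k => by ring
    simp only [scale, Sum.elim_inr, e, Finset.sum_sub_distrib]
    linear_combination -this
  refine ⟨c, funext ?_, ?_⟩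
  · rintro ⟨j, (k | j') | k⟩
    · exact hc k j
    · simp only [lawrence]
      split_ifs with hj
      · rw [hscale, hj]
      · exact hrow _ _ (Ne.symm hj)
    · rfl
  · rintro (k | j)
    · exact hc0 k
    · rw [hscale]
      exact hdiag j

theorem mem_faceSpace_lawrence {x₀ x : J × I → ℝ} {c : I → ℝ} (hc : ∀ e, 0 < scale x c e) :
    lawrence x c ∈ faceSpace (lawrence x₀ 1) ↔ x ∈ oriented x₀ := by
  have h1 : ∀ e, 0 < scale x₀ 1 e := fun e => by
    rw [scale_one]
    exact one_pos
  simp only [faceSpace, oriented, Set.mem_ofPred_eq, covLE_iff_coneSupportSet hc h1,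
    covLE_iff_coneSupportSet h1 hc, sum_lawrence, implies_true, true_and]
  exact ⟨fun h => ⟨fun S => (h S).2, fun S => (h S).1⟩, fun h S => ⟨h.2 S, h.1 S⟩⟩

theorem seq_faceSpace {x₀ : J × I → ℝ} (hx₀ : ∀ k, ∃ j, x₀ (j, k) ≠ 0) :
    SEq (oriented x₀) (faceSpace (lawrence x₀ 1)) := by
  refine (SEq.of_fibre (T := {z | (fun p => z (.inl p)) ∈ oriented x₀ ∧
    (∀ _ : Empty, (0 : ℝ) = 0) ∧ ∀ e : I ⊕ J, 0 < scale (fun p => z (.inl p))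
      (fun k => z (.inr k)) e}) (fun _ _ _ => 0) (fun e x y => scale x y e) (fun b => b.elim)
    ?_ (fun x y => Iff.rfl)
    (fun x _ => ⟨1, fun _ => rfl, fun e => by rw [scale_one]; exact one_pos⟩)).trans ?_
  · rintro (k | j)
    · exact .coord k
    · exact (FibreAffine.base (.const 1)).sub (.sum _ fun k _ =>
        .smul (.coord _) ((FibreAffine.base (.const 1)).sub (.coord k)))
  choose j hj using hx₀
  have key : ∀ z ∈ faceSpace (lawrence x₀ 1), ∃ c,
      z = lawrence (fun p => z (p.1, .inr p.2)) c ∧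
      (∀ e, 0 < scale (fun p : J × I => z (p.1, .inr p.2)) c e) ∧
      (fun p : J × I => z (p.1, .inr p.2)) ∈ oriented x₀ := by
    intro z hz
    obtain ⟨c, h1, h2⟩ := exists_eq_lawrence hz.1 fun e =>
      (hz.2 _).2 (coneSupportSet_lawrence_pair (fun e => by rw [scale_one]; exact one_pos) e)
    refine ⟨c, h1, h2, ?_⟩
    rwa [← mem_faceSpace_lawrence h2, ← h1]
  have ne : ∀ z ∈ faceSpace (lawrence x₀ 1), ∀ k, z (j k, .inr k) ≠ 0 := fun z hz k => by
    obtain ⟨-, -, -, h⟩ := key z hz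
    have := h.1.sign_eq (j k) k
    intro h0
    rw [h0, sign_zero, sign_eq_zero_iff] at this
    exact hj k this
  have hcoef : ∀ z ∈ faceSpace (lawrence x₀ 1), ∀ c,
      z = lawrence (fun p => z (p.1, .inr p.2)) c →
      (fun k => (0 - z (j k, .inl (.inl k))) / z (j k, .inr k)) = c := by
    intro z hz c hc
    funext k
    rw [div_eq_iff (ne z hz k), congrFun hc (j k, .inl (.inl k))]
    simp [lawrence]
  refine SEq.of_ratOn (fun z => lawrence (fun p => z (.inl p)) (fun k => z (.inr k)))
    (fun z => Sum.elim (fun p => z (p.1, .inr p.2))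
      (fun k => (0 - z (j k, .inl (.inl k))) / z (j k, .inr k))) ?_ ?_ ?_ ?_ ?_ ?_
  · rintro ⟨j, (k | j') | k⟩
    · exact ((PolyFn.coord _).mul (.coord _)).neg.ratOn _
    · simp only [lawrence]
      split_ifs
      · exact ((PolyFn.const 1).sub (.sum _ fun k _ =>
          (PolyFn.coord _).mul ((PolyFn.const 1).sub (.coord _)))).ratOn _
      · exact .const 0
    · exact .coord _
  · rintro (p | k)
    · exact .coord _
    · exact ((RatOn.const 0).sub (.coord _)).div (.coord _) fun z hz => ne z hz k
  · rintro z ⟨hz, -, hc⟩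
    exact (mem_faceSpace_lawrence hc).2 hz
  · intro z hz
    obtain ⟨c, h1, h2, h3⟩ := key z hz
    have := hcoef z hz c h1
    exact ⟨h3, fun _ => rfl, by simpa only [Sum.elim_inl, Sum.elim_inr, this] using h2⟩
  · rintro z ⟨hz, -, hc⟩
    funext i
    rcases i with p | k
    · rfl
    · exact congrFun (hcoef _ ((mem_faceSpace_lawrence hc).2 hz) _ rfl) k
  · intro z hz
    obtain ⟨c, h1, -⟩ := key z hz
    simp only [Sum.elim_inl, Sum.elim_inr, hcoef z hz c h1]
    exact h1.symm

end Lawrence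

section Flat

variable {n d : ℕ}

/-- The indexing of the coordinates of a flattened point configuration. -/
def flatEquiv : Fin n × Fin d ≃ Fin (d * n) := finProdFinEquiv.trans (finCongr (mul_comm n d))

theorem flatEquiv_apply (p : Fin n) (c : Fin d) : flatEquiv (p, c) = flatIdx p c := by
  ext
  simp [flatEquiv, flatIdx, add_comm]

end Flat

theorem sum_mul_eq_of_sum_eq_one {K : Type*} [Fintype K] {d : ℕ} (e : K ≃ Fin (d + 1))
    (ψ y : K → ℝ) (hy : ∑ k, y k = 1) :
    ∑ k, ψ k * y k = ψ (e.symm 0) +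
      ∑ c : Fin d, (ψ (e.symm c.succ) - ψ (e.symm 0)) * y (e.symm c.succ) := by
  rw [← e.symm.sum_comp, Fin.sum_univ_succ] at hy ⊢
  simp only [sub_mul, Finset.sum_sub_distrib, ← Finset.mul_sum]
  linear_combination ψ (e.symm 0) * hy

/-- The vertices forming the barycentric frame, among all vertices. -/
def frame {I J : Type*} : (I ⊕ J) ⊕ I ↪ (I ⊕ J) ⊕ (I ⊕ J) :=
  ⟨Sum.map id .inl, Function.injective_id.sumMap Sum.inl_injective⟩

/-- The vertices normalized in the realization space. -/
def frameFinset {I J : Type*} [Fintype I] [Fintype J] {n : ℕ}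
    (εV : (I ⊕ J) ⊕ (I ⊕ J) ≃ Fin n) : Finset (Fin n) :=
  Finset.univ.map (frame.trans εV.toEmbedding)

theorem card_frameFinset {I J : Type*} [Fintype I] [Fintype J] {n d : ℕ}
    (εV : (I ⊕ J) ⊕ (I ⊕ J) ≃ Fin n) (εK : (I ⊕ J) ⊕ I ≃ Fin (d + 1)) :
    (frameFinset εV).card = d + 1 := by
  rw [frameFinset, Finset.card_map, Finset.card_univ, Fintype.card_congr εK, Fintype.card_fin]

/-- The barycentric coordinates of the last vertices of a point configuration. -/
def ofFlat {I J : Type*} {n d : ℕ} (εV : (I ⊕ J) ⊕ (I ⊕ J) ≃ Fin n) (εK : (I ⊕ J) ⊕ I ≃ Fin (d + 1))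
    (y : Fin (d * n) → ℝ) (p : J × ((I ⊕ J) ⊕ I)) : ℝ :=
  (Fin.cons (1 - ∑ c, y (flatIdx (εV (.inr (.inr p.1))) c))
    fun c => y (flatIdx (εV (.inr (.inr p.1))) c) : Fin (d + 1) → ℝ) (εK p.2)

theorem sum_ofFlat {I J : Type*} [Fintype I] [Fintype J] {n d : ℕ}
    (εV : (I ⊕ J) ⊕ (I ⊕ J) ≃ Fin n) (εK : (I ⊕ J) ⊕ I ≃ Fin (d + 1)) (y : Fin (d * n) → ℝ)
    (j : J) : ∑ k, ofFlat εV εK y (j, k) = 1 := by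
  rw [← εK.symm.sum_comp, Fin.sum_univ_succ]
  simp [ofFlat]

section Lawrence

variable {I J : Type*} [DecidableEq I] [DecidableEq J] {n d : ℕ}

/-- The vertices of the polytope with barycentric coordinates `lift z`. -/
def verts (εV : (I ⊕ J) ⊕ (I ⊕ J) ≃ Fin n) (εK : (I ⊕ J) ⊕ I ≃ Fin (d + 1))
    (z : J × ((I ⊕ J) ⊕ I) → ℝ)
    (p : Fin n) (c : Fin d) : ℝ :=
  lift z (εV.symm p) (εK.symm c.succ)

theorem lift_frame (z : J × ((I ⊕ J) ⊕ I) → ℝ) (k : (I ⊕ J) ⊕ I) :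
    lift z (frame k) = Pi.single k 1 := by
  rcases k with e | k <;> rfl

variable {εV : (I ⊕ J) ⊕ (I ⊕ J) ≃ Fin n} {εK : (I ⊕ J) ⊕ I ≃ Fin (d + 1)}
  {z z₀ : J × ((I ⊕ J) ⊕ I) → ℝ}

theorem affineIndependent_frame :
    AffineIndependent ℝ fun k => verts εV εK z (εV (frame k)) := by
  rw [affineIndependent_iff]
  intro s w h0 h1
  have key : ∀ c : Fin d, εK.symm c.succ ∈ s → w (εK.symm c.succ) = 0 := fun c hc => by
    have := congrFun h1 c
    simpa [verts, lift_frame, Pi.single_apply, hc] using this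
  have key' : ∀ k ∈ s, εK k ≠ 0 → w k = 0 := fun k hk hne => by
    obtain ⟨c, hc⟩ := Fin.exists_succ_eq.2 hne
    have e : εK.symm c.succ = k := by rw [hc, Equiv.symm_apply_apply]
    exact e ▸ key c (e.symm ▸ hk)
  intro k hk
  by_cases h : εK k = 0
  · rwa [Finset.sum_eq_single_of_mem k hk fun l hl hne => key' l hl fun h' =>
      hne (εK.injective (h'.trans h.symm))] at h0
  · exact key' k hk h

variable [Fintype I] [Fintype J]

theorem sum_lift (hz : ∀ j, ∑ k, z (j, k) = 1) (i) : ∑ k, lift z i k = 1 := by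
  rcases i with e | k | j
  · simp [lift]
  · simp [lift]
  · exact hz j

theorem supportSet_verts (hz : ∀ j, ∑ k, z (j, k) = 1) (S : Finset (Fin n)) :
    SupportSet (verts εV εK z) S ↔ ConeSupportSet (lift z) {i | εV i ∈ S} := by
  constructor
  · rintro ⟨w, c, h⟩
    refine ⟨fun k => (Fin.cons c fun l => c + w l : Fin (d + 1) → ℝ) (εK k), fun i => ?_⟩
    rw [sum_mul_eq_of_sum_eq_one εK _ _ (sum_lift hz i)]
    simpa [verts] using h (εV i)
  · rintro ⟨ψ, h⟩
    refine ⟨fun c => ψ (εK.symm c.succ) - ψ (εK.symm 0), ψ (εK.symm 0), fun i => ?_⟩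
    have := h (εV.symm i)
    rw [sum_mul_eq_of_sum_eq_one εK _ _ (sum_lift hz _)] at this
    simpa [verts] using this

theorem forall_supportSet_verts_iff (hz : ∀ j, ∑ k, z (j, k) = 1)
    (hz₀ : ∀ j, ∑ k, z₀ (j, k) = 1) :
    (∀ S, SupportSet (verts εV εK z) S ↔ SupportSet (verts εV εK z₀) S) ↔
      ∀ S, ConeSupportSet (lift z) S ↔ ConeSupportSet (lift z₀) S := by
  classical
  simp only [supportSet_verts hz, supportSet_verts hz₀]
  refine ⟨fun h S => ?_, fun h S => h _⟩
  simpa using h (Finset.univ.filter fun i => εV.symm i ∈ S)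

theorem verts_of_mem_frameFinset {i : Fin n} (hi : i ∈ frameFinset εV) :
    verts εV εK z i = verts εV εK z₀ i := by
  obtain ⟨k, -, rfl⟩ := Finset.mem_map.1 hi
  funext c
  simp [verts, lift_frame]

theorem affineIndependent_frameFinset :
    AffineIndependent ℝ fun i : ↥(frameFinset εV) => verts εV εK z i := by
  have hmem : ∀ i : ↥(frameFinset εV), ∃ k, εV (frame k) = i := fun i => by
    obtain ⟨k, -, hk⟩ := Finset.mem_map.1 i.2
    exact ⟨k, hk⟩
  choose f hf using hmem
  have hinj : Function.Injective f := fun i j h => Subtype.ext (by rw [← hf i, ← hf j, h])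
  have := (affineIndependent_frame (εV := εV) (εK := εK) (z := z)).comp_embedding ⟨f, hinj⟩
  simpa only [Function.comp_def, Function.Embedding.coeFn_mk, hf] using this

theorem affineSpan_verts : affineSpan ℝ (Set.range (verts εV εK z)) = ⊤ := by
  rw [eq_top_iff, ← (affineIndependent_frame (εV := εV) (εK := εK)
    (z := z)).affineSpan_eq_top_iff_card_eq_finrank_add_one.2
    (by rw [Module.finrank_fin_fun, Fintype.card_congr εK, Fintype.card_fin])]
  exact affineSpan_mono ℝ (Set.range_comp_subset_range (fun k => εV (frame k)) (verts εV εK z))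

theorem verts_ofFlat {y : Fin (d * n) → ℝ}
    (hy : ∀ i ∈ frameFinset εV, (fun c => y (flatIdx i c)) = verts εV εK z₀ i) (i : Fin n)
    (c : Fin d) : verts εV εK (ofFlat εV εK y) i c = y (flatIdx i c) := by
  obtain ⟨q, rfl⟩ := εV.surjective i
  by_cases hq : ∃ k, frame k = q
  · obtain ⟨k, rfl⟩ := hq
    have hmem : εV (frame k) ∈ frameFinset εV := Finset.mem_map.2 ⟨k, Finset.mem_univ _, rfl⟩
    rw [verts_of_mem_frameFinset (z₀ := z₀) hmem, ← hy _ hmem]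
  · rcases q with e | k | j
    · exact absurd ⟨.inl e, rfl⟩ hq
    · exact absurd ⟨.inr k, rfl⟩ hq
    · simp [verts, lift, ofFlat]

theorem ofFlat_verts {y : Fin (d * n) → ℝ} (hz : ∀ j, ∑ k, z (j, k) = 1)
    (hy : ∀ i c, y (flatIdx i c) = verts εV εK z i c) : ofFlat εV εK y = z := by
  funext ⟨j, k⟩
  obtain ⟨l, rfl⟩ := εK.symm.surjective k
  have e : ∀ c : Fin d, y (flatIdx (εV (.inr (.inr j))) c) = z (j, εK.symm c.succ) := fun c => by
    simp [hy, verts, lift]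
  simp only [ofFlat, e, Equiv.apply_symm_apply]
  have := hz j
  rw [← εK.symm.sum_comp, Fin.sum_univ_succ] at this
  refine Fin.cases ?_ (fun c => ?_) l
  · rw [Fin.cons_zero]
    linarith
  · rw [Fin.cons_succ]

theorem seq_flat (hz₀ : ∀ j, ∑ k, z₀ (j, k) = 1)
    (hv : ∀ i, SupportSet (verts εV εK z₀) {i})
    (hn : ∀ j, ¬ SupportSet (verts εV εK z₀) (Finset.univ.erase j)) :
    SEq (faceSpace z₀) (flat (polytopeRealizationSpace (verts εV εK z₀) (frameFinset εV))) := by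
  have mem : ∀ y, y ∈ flat (polytopeRealizationSpace (verts εV εK z₀) (frameFinset εV)) ↔
      (∀ i ∈ frameFinset εV, (fun c => y (flatIdx i c)) = verts εV εK z₀ i) ∧
      ∀ S, SupportSet (fun i c => y (flatIdx i c)) S ↔ SupportSet (verts εV εK z₀) S :=
    fun y => mem_realizationSpace_iff hv hn
  have hflat : ∀ (z : J × ((I ⊕ J) ⊕ I) → ℝ) (i : Fin n) (c : Fin d),
      verts εV εK z (flatEquiv.symm (flatIdx i c)).1 (flatEquiv.symm (flatIdx i c)).2 =
        verts εV εK z i c := fun z i c => by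
    rw [← flatEquiv_apply, Equiv.symm_apply_apply]
  refine SEq.of_ratOn
    (fun z i => verts εV εK z (flatEquiv.symm i).1 (flatEquiv.symm i).2) (ofFlat εV εK)
    (fun i => ?_) ?_ (fun z hz => ?_) (fun y hy => ?_) (fun z hz => ?_) (fun y hy => ?_)
  · simp only [verts]
    generalize εV.symm _ = q
    rcases q with e | k | j
    · exact .const _
    · exact .const _
    · exact .coord _
  · rintro ⟨j, k⟩
    simp only [ofFlat]
    generalize εK k = l
    refine Fin.cases ?_ (fun c => ?_) l
    · exact ((PolyFn.const 1).sub (.sum _ fun c _ => .coord _)).ratOn _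
    · exact .coord _
  · rw [mem]
    simp only [hflat]
    exact ⟨fun i hi => verts_of_mem_frameFinset hi,
      (forall_supportSet_verts_iff hz.1 hz₀).2 hz.2⟩
  · obtain ⟨h1, h2⟩ := (mem y).1 hy
    refine ⟨sum_ofFlat εV εK y, (forall_supportSet_verts_iff (sum_ofFlat εV εK y) hz₀
      (εV := εV) (εK := εK)).1 ?_⟩
    rwa [show verts εV εK (ofFlat εV εK y) = fun i c => y (flatIdx i c) from
      funext fun i => funext fun c => verts_ofFlat h1 i c]
  · exact ofFlat_verts hz.1 (hflat z)
  · funext i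
    rw [verts_ofFlat ((mem y).1 hy).1, ← flatEquiv_apply, Prod.mk.eta, Equiv.apply_symm_apply]

theorem exists_polytope_seq_oriented [Nonempty I] {x₀ : J × I → ℝ}
    (hrow : ∀ j, ∃ k, x₀ (j, k) ≠ 0) (hcol : ∀ k, ∃ j, x₀ (j, k) ≠ 0) :
    ∃ (d n : ℕ) (v : Fin n → Fin d → ℝ) (B : Finset (Fin n)), IsPolytopeVertexList v ∧
      B.card = d + 1 ∧ AffineIndependent ℝ (fun i : ↥B => v i) ∧
      SEq (oriented x₀) (flat (polytopeRealizationSpace v B)) := by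
  obtain ⟨d, hd⟩ := Nat.exists_eq_succ_of_ne_zero
    (Fintype.card_ne_zero (α := (I ⊕ J) ⊕ I))
  have εK := Fintype.equivFinOfCardEq hd
  have εV := Fintype.equivFin ((I ⊕ J) ⊕ (I ⊕ J))
  have hz := sum_lawrence x₀ 1
  have hs : ∀ e, 0 < scale x₀ 1 e := fun e => by
    rw [scale_one]
    exact one_pos
  have hv : ∀ i, SupportSet (verts εV εK (lawrence x₀ 1)) {i} := fun i => by
    rw [supportSet_verts hz]
    convert coneSupportSet_lawrence_singleton hs hrow (εV.symm i) using 1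
    ext
    simp [Equiv.eq_symm_apply]
  have hn : ∀ i, ¬ SupportSet (verts εV εK (lawrence x₀ 1)) (Finset.univ.erase i) := fun i => by
    rw [supportSet_verts hz]
    convert not_coneSupportSet_lawrence_compl hs hcol (εV.symm i) using 2
    ext
    simp [Equiv.eq_symm_apply]
  exact ⟨d, _, verts εV εK (lawrence x₀ 1), frameFinset εV, ⟨injective_of_supportSet hv,
    mem_extremePoints_of_supportSet hv, affineSpan_verts⟩, card_frameFinset εV εK,
    affineIndependent_frameFinset, (seq_faceSpace hcol).trans (seq_flat hz hv hn)⟩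

end Lawrence

namespace Shor

variable {M : Shor}

theorem exists_conf_row_ne_zero (x : Fin (M.n + 1) → ℝ) {p : M.Par → ℝ} (hp : ∀ b, 0 < p b)
    (r : M.Row) : ∃ c, M.conf x p (r, c) ≠ 0 := by
  rcases r with i | ⟨g, b⟩
  · exact ⟨.inl 0, by simp [conf, (hp _).ne']⟩
  · exact ⟨.inr g, by simp [conf, (hp _).ne']⟩

theorem exists_conf_col_ne_zero {x : Fin (M.n + 1) → ℝ} (hx : x ∈ M.sol) {p : M.Par → ℝ}
    (hp : ∀ b, 0 < p b) (c : M.Col) : ∃ r, M.conf x p (r, c) ≠ 0 := by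
  rcases c with b | g
  · have := (one_pos.trans_le (one_le_of_mem_sol hx 0)).ne'
    refine ⟨.inl 0, ?_⟩
    simp only [conf]
    split_ifs <;> simp [(hp _).ne', this]
  · exact ⟨.inr (g, 0), by simp [conf, (hp _).ne']⟩

end Shor

end Universality

/-- **Universality for polytopes** (Theorem 1.1(ii)).
Every nonempty primary basic semialgebraic set defined over `ℤ` is stably equivalent to the
realization space of some polytope. -/
theorem universality_polytopes (m : ℕ) (V : Set (Fin m → ℝ))
    (hV : IsPrimaryBasicSemialgebraicZ V) (hVne : V.Nonempty) :
    ∃ (d n : ℕ) (v : Fin n → Fin d → ℝ) (B : Finset (Fin n)),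
      IsPolytopeVertexList v ∧
      B.card = d + 1 ∧
      AffineIndependent ℝ (fun i : ↥B => v i) ∧
      StablyEquivalent ⟨m, V⟩ ⟨d * n, flat (polytopeRealizationSpace v B)⟩ := by
  obtain ⟨s, hs⟩ := Universality.exists_sys hV
  rw [← s.sol_toShor] at hs
  obtain ⟨x₀, hx₀⟩ := hs.nonempty hVne
  have hp : ∀ b, 0 < (1 : s.toShor.Par → ℝ) b := fun _ => one_pos
  obtain ⟨d, n, v, B, hv, hB, hB', h⟩ := Universality.exists_polytope_seq_oriented
    (Universality.Shor.exists_conf_row_ne_zero x₀ hp)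
    (Universality.Shor.exists_conf_col_ne_zero hx₀ hp)
  exact ⟨d, n, v, B, hv, hB, hB',
    ((hs.trans (Universality.Shor.seq_oriented hx₀ hp)).trans h).stablyEquivalent⟩
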